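/- Let n ≥ 3 with 1 < p < ∞, or n ≥ 4 with p = 1, and let Φ map P_o^n to C_p(ℝ^n). Assume that Φ(P) is non-negative and (Φ(P))^{1/p} is sublinear for every P ∈ P_o^n. Then Φ is an SL(n) covariant valuation if and only if there exist constants a₁, b₁, c₁, c₂ ≥ 0 such that Φ(P) = c₁·h_{M_p⁺P}^p + c₂·h_{M_p⁻P}^p + a₁·h_P^p + b₁·h_{−P}^p for every P ∈ P_o^n. -/

import Mathlib

open scoped RealInnerProductSpace BigOperators Pointwise ENNReal
open MeasureTheory Filter Matrix

noncomputable section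

/-- `Euc n` is Euclidean space `ℝ^n`. -/
abbrev Euc (n : ℕ) := EuclideanSpace ℝ (Fin n)

/-- A convex body in `ℝ^n` containing the origin: a nonempty compact convex set with `0 ∈ K`. -/
def IsConvexBody0 {n : ℕ} (K : Set (Euc n)) : Prop :=
  IsCompact K ∧ Convex ℝ K ∧ (0 : Euc n) ∈ K

/-- A convex polytope in `ℝ^n` containing the origin. -/
def IsPolytope0 {n : ℕ} (P : Set (Euc n)) : Prop :=
  (∃ S : Finset (Euc n), P = convexHull ℝ (S : Set (Euc n))) ∧ (0 : Euc n) ∈ P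

/-- The support function `h_K(x) = sup { ⟪x, y⟫ : y ∈ K }`. -/
def supp {n : ℕ} (K : Set (Euc n)) (x : Euc n) : ℝ :=
  sSup ((fun y => ⟪x, y⟫) '' K)

/-- The image of a set under the linear map induced by a matrix. -/
def matAct {n : ℕ} (A : Matrix (Fin n) (Fin n) ℝ) (K : Set (Euc n)) : Set (Euc n) :=
  (Matrix.toEuclideanLin A) '' K

/-- The vector `A x`. -/
def matVec {n : ℕ} (A : Matrix (Fin n) (Fin n) ℝ) (x : Euc n) : Euc n :=
  Matrix.toEuclideanLin A x

/-- The dimension of a set: the dimension of (the direction of) its affine hull. -/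
def sdim {n : ℕ} (P : Set (Euc n)) : ℕ :=
  Module.finrank ℝ (affineSpan ℝ P).direction

/-- Support function of the asymmetric `L_p` moment body:
`h_{M_p⁺K}(x) = (∫_K max(⟪x,y⟫,0)^p dy)^(1/p)`. -/
def mPlus {n : ℕ} (p : ℝ) (K : Set (Euc n)) (x : Euc n) : ℝ :=
  (∫ y in K, max ⟪x, y⟫ 0 ^ p) ^ (1 / p)

/-- Support function of the asymmetric `L_p` moment body `M_p⁻`. -/
def mMinus {n : ℕ} (p : ℝ) (K : Set (Euc n)) (x : Euc n) : ℝ :=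
  (∫ y in K, max (-⟪x, y⟫) 0 ^ p) ^ (1 / p)

/-- The convex hull of a set together with the origin. -/
def hull0 {n : ℕ} (S : Set (Euc n)) : Set (Euc n) := convexHull ℝ (insert 0 S)

/-- The valuation property on polytopes containing the origin. -/
def IsVal {n : ℕ} (ψ : Set (Euc n) → ℝ) : Prop :=
  ∀ K L : Set (Euc n), IsPolytope0 K → IsPolytope0 L → IsPolytope0 (K ∪ L) →
    IsPolytope0 (K ∩ L) → ψ (K ∪ L) + ψ (K ∩ L) = ψ K + ψ L

section Hull

variable {n : ℕ}

lemma convex_hull0 (S : Set (Euc n)) : Convex ℝ (hull0 S) := convex_convexHull ℝ _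

lemma zero_mem_hull0 (S : Set (Euc n)) : (0 : Euc n) ∈ hull0 S :=
  subset_convexHull ℝ _ (Set.mem_insert _ _)

lemma subset_hull0 (S : Set (Euc n)) : S ⊆ hull0 S :=
  (Set.subset_insert _ _).trans (subset_convexHull ℝ _)

lemma hull0_mono {S T : Set (Euc n)} (h : S ⊆ T) : hull0 S ⊆ hull0 T :=
  convexHull_mono (Set.insert_subset_insert h)

lemma hull0_subset {S T : Set (Euc n)} (h : S ⊆ hull0 T) : hull0 S ⊆ hull0 T :=
  convexHull_min (Set.insert_subset (zero_mem_hull0 T) h) (convex_hull0 T)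

lemma isPolytope0_hull0 {S : Set (Euc n)} (hS : S.Finite) : IsPolytope0 (hull0 S) :=
  ⟨⟨(hS.insert 0).toFinset, by simp [hull0]⟩, zero_mem_hull0 S⟩

lemma IsPolytope0.exists_hull0 {P : Set (Euc n)} (hP : IsPolytope0 P) :
    ∃ V : Finset (Euc n), P = hull0 (V : Set (Euc n)) := by
  obtain ⟨⟨V, rfl⟩, h0⟩ := hP
  refine ⟨V, (convexHull_mono (Set.subset_insert _ _)).antisymm ?_⟩
  exact convexHull_min (Set.insert_subset h0 (subset_convexHull ℝ _)) (convex_convexHull ℝ _)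

lemma IsPolytope0.isCompact {P : Set (Euc n)} (hP : IsPolytope0 P) : IsCompact P := by
  obtain ⟨⟨V, rfl⟩, -⟩ := hP
  exact V.finite_toSet.isCompact_convexHull ℝ

lemma IsPolytope0.convex {P : Set (Euc n)} (hP : IsPolytope0 P) : Convex ℝ P := by
  obtain ⟨⟨V, rfl⟩, -⟩ := hP
  exact convex_convexHull ℝ _

lemma matAct_hull0 (A : Matrix (Fin n) (Fin n) ℝ) (S : Set (Euc n)) :
    matAct A (hull0 S) = hull0 (matVec A '' S) := by
  unfold matAct hull0
  rw [LinearMap.image_convexHull, Set.image_insert_eq, map_zero]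
  rfl

lemma Convex.combo_three_mem {C : Set (Euc n)} (hC : Convex ℝ C) {x y z : Euc n}
    (hx : x ∈ C) (hy : y ∈ C) (hz : z ∈ C) {a b c : ℝ} (ha : 0 ≤ a) (hb : 0 ≤ b) (hc : 0 ≤ c)
    (h : a + b + c = 1) : a • x + b • y + c • z ∈ C := by
  have := hC.sum_mem (t := Finset.univ) (w := ![a, b, c]) (z := ![x, y, z])
    (by intro i _; fin_cases i <;> simpa) (by simp [Fin.sum_univ_three, h])
    (by intro i _; fin_cases i <;> simpa)
  simpa [Fin.sum_univ_three] using this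

lemma mem_hull0_insert {a x : Euc n} {S : Set (Euc n)} :
    x ∈ hull0 (insert a S) ↔
      ∃ s t : ℝ, 0 ≤ s ∧ 0 ≤ t ∧ s + t = 1 ∧ ∃ c ∈ hull0 S, x = s • a + t • c := by
  unfold hull0
  rw [Set.insert_comm, convexHull_insert (Set.insert_nonempty _ _), mem_convexJoin]
  constructor
  · rintro ⟨a', rfl, c, hc, s, t, hs, ht, hst, rfl⟩
    exact ⟨s, t, hs, ht, hst, c, hc, rfl⟩
  · rintro ⟨s, t, hs, ht, hst, c, hc, rfl⟩
    exact ⟨a, rfl, c, hc, s, t, hs, ht, hst, rfl⟩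

lemma mem_hull0_insert_insert {a b x : Euc n} {S : Set (Euc n)} :
    x ∈ hull0 (insert a (insert b S)) ↔
      ∃ r s t : ℝ, 0 ≤ r ∧ 0 ≤ s ∧ 0 ≤ t ∧ r + s + t = 1 ∧
        ∃ c ∈ hull0 S, x = r • a + s • b + t • c := by
  constructor
  · intro hx
    obtain ⟨s, t, hs, ht, hst, c, hc, rfl⟩ := mem_hull0_insert.1 hx
    obtain ⟨s', t', hs', ht', hst', c', hc', rfl⟩ := mem_hull0_insert.1 hc
    refine ⟨s, t * s', t * t', hs, by positivity, by positivity, ?_, c', hc', ?_⟩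
    · linear_combination hst + t * hst'
    · module
  · rintro ⟨r, s, t, hr, hs, ht, h, c, hc, rfl⟩
    refine (convex_hull0 _).combo_three_mem (subset_hull0 _ (by simp)) (subset_hull0 _ (by simp))
      (hull0_mono ?_ hc) hr hs ht h
    exact (Set.subset_insert _ _).trans (Set.subset_insert _ _)

lemma mem_hull0_of_openSegment {a b w : Euc n} (hw : w ∈ openSegment ℝ a b) {S : Set (Euc n)}
    (ha : a ∈ hull0 S) (hb : b ∈ hull0 S) : w ∈ hull0 S :=
  (convex_hull0 S).openSegment_subset ha hb hw

lemma hull0_union_cut {a b w : Euc n} (hw : w ∈ openSegment ℝ a b) (S : Set (Euc n)) :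
    hull0 (insert a (insert w S)) ∪ hull0 (insert b (insert w S)) =
      hull0 (insert a (insert b S)) := by
  have hsub : insert w S ⊆ hull0 (insert a (insert b S)) := by
    rintro z (rfl | hz)
    · exact mem_hull0_of_openSegment hw (subset_hull0 _ (by simp)) (subset_hull0 _ (by simp))
    · exact subset_hull0 _ (by simp [hz])
  apply Set.Subset.antisymm
  · apply Set.union_subset <;> apply hull0_subset <;> apply Set.insert_subset _ hsub <;>
      exact subset_hull0 _ (by simp)
  · intro x hx
    obtain ⟨r, s, t, hr, hs, ht, h, c, hc, rfl⟩ := mem_hull0_insert_insert.1 hx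
    obtain ⟨u, v, hu, hv, huv, rfl⟩ := hw
    rcases le_total (s * u) (r * v) with hle | hle
    · left
      rw [mem_hull0_insert_insert]
      refine ⟨r - s * u / v, s / v, t, ?_, by positivity, ht, ?_, c, hc, ?_⟩
      · rw [sub_nonneg, div_le_iff₀ hv]; exact hle
      · field_simp
        linear_combination v * h - s * huv
      · match_scalars <;> field_simp <;> ring
    · right
      rw [mem_hull0_insert_insert]
      refine ⟨s - r * v / u, r / u, t, ?_, by positivity, ht, ?_, c, hc, ?_⟩
      · rw [sub_nonneg, div_le_iff₀ hu]; exact hle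
      · field_simp
        linear_combination u * h - r * huv
      · match_scalars <;> field_simp <;> ring

lemma hull0_inter_cut {a b w : Euc n} (hw : w ∈ openSegment ℝ a b) (S : Set (Euc n)) :
    hull0 (insert a (insert w S)) ∩ hull0 (insert b (insert w S)) = hull0 (insert w S) := by
  apply Set.Subset.antisymm
  · rintro x ⟨hx, hx'⟩
    obtain ⟨r, s, t, hr, hs, ht, h, c, hc, hxe⟩ := mem_hull0_insert_insert.1 hx
    obtain ⟨r', s', t', hr', hs', ht', h', c', hc', hxe'⟩ := mem_hull0_insert_insert.1 hx'
    obtain ⟨u, v, hu, hv, huv, hwe⟩ := hw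
    have hwC : w ∈ hull0 (insert w S) := subset_hull0 _ (by simp)
    have hcC := hull0_mono (Set.subset_insert w S) hc
    have hcC' := hull0_mono (Set.subset_insert w S) hc'
    rcases eq_or_lt_of_le hr with hr0 | hr0
    · have := (convex_hull0 (insert w S)).combo_three_mem hwC hwC hcC hr hs ht h
      rw [hxe]
      simpa [← hr0] using this
    · set d := r * v + r' * u with hd
      have hd0 : 0 < d := by positivity
      have hx2 : x = (r' * u / d) • x + (r * v / d) • x := by
        rw [← add_smul, ← add_div, add_comm, ← hd, div_self hd0.ne', one_smul]
      have key : x = (r' * r / d + r' * u / d * s + r * v / d * s') • w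
          + (r' * u / d * t) • c + (r * v / d * t') • c' := by
        have e : (r' * r / d) • w = (r' * u / d * r) • a + (r * v / d * r') • b := by
          rw [← hwe]; match_scalars <;> ring
        calc x = (r' * u / d) • x + (r * v / d) • x := hx2
          _ = (r' * u / d) • (r • a + s • w + t • c)
              + (r * v / d) • (r' • b + s' • w + t' • c') := by rw [← hxe, ← hxe']
          _ = ((r' * u / d * r) • a + (r * v / d * r') • b)
              + ((r' * u / d * s + r * v / d * s') • w
              + (r' * u / d * t) • c + (r * v / d * t') • c') := by module
          _ = _ := by rw [← e]; module
      rw [key]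
      refine (convex_hull0 _).combo_three_mem hwC hcC hcC' (by positivity) (by positivity)
        (by positivity) ?_
      have hs1 : s = 1 - r - t := by linarith
      have hs1' : s' = 1 - r' - t' := by linarith
      rw [hs1, hs1']
      field_simp
      rw [hd]
      linear_combination (-(r * r')) * huv
  · exact Set.subset_inter (hull0_mono (Set.subset_insert _ _)) (hull0_mono (Set.subset_insert _ _))

lemma IsVal.cut {ψ : Set (Euc n) → ℝ} (hψ : IsVal ψ) {a b w : Euc n}
    (hw : w ∈ openSegment ℝ a b) {S : Set (Euc n)} (hS : S.Finite) :
    ψ (hull0 (insert a (insert b S))) + ψ (hull0 (insert w S)) =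
      ψ (hull0 (insert a (insert w S))) + ψ (hull0 (insert b (insert w S))) := by
  have h := hψ (hull0 (insert a (insert w S))) (hull0 (insert b (insert w S)))
    (isPolytope0_hull0 ((hS.insert _).insert _)) (isPolytope0_hull0 ((hS.insert _).insert _))
  rw [hull0_union_cut hw, hull0_inter_cut hw] at h
  exact h (isPolytope0_hull0 ((hS.insert _).insert _)) (isPolytope0_hull0 (hS.insert _))

lemma hull0_erase_eq [DecidableEq (Euc n)] {V : Finset (Euc n)} {a : Euc n}
    (h : a ∈ hull0 ((V.erase a : Finset (Euc n)) : Set (Euc n))) :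
    hull0 (V : Set (Euc n)) = hull0 ((V.erase a : Finset (Euc n)) : Set (Euc n)) := by
  apply Set.Subset.antisymm
  · apply hull0_subset
    intro z hz
    by_cases hza : z = a
    · exact hza ▸ h
    · exact subset_hull0 _ (by simpa [hza] using hz)
  · exact hull0_mono (by simp)

lemma smul_mem_hull0 {S : Set (Euc n)} {a : Euc n} (ha : a ∈ S) {μ : ℝ} (h0 : 0 ≤ μ)
    (h1 : μ ≤ 1) : μ • a ∈ hull0 S :=
  (convex_hull0 S).smul_mem_of_zero_mem (zero_mem_hull0 S) (subset_hull0 S ha) ⟨h0, h1⟩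

open Classical in
/-- A valuation that vanishes on simplices with one vertex at the origin vanishes. -/
theorem IsVal.eq_zero {ψ : Set (Euc n) → ℝ} (hψ : IsVal ψ)
    (hind : ∀ V : Finset (Euc n), LinearIndependent ℝ ((↑) : V → Euc n) →
      ψ (hull0 (V : Set (Euc n))) = 0)
    (V : Finset (Euc n)) : ψ (hull0 (V : Set (Euc n))) = 0 := by
  induction hm : V.card using Nat.strong_induction_on generalizing V with
  | _ m ih =>
  by_cases hV : LinearIndependent ℝ ((↑) : V → Euc n)
  · exact hind V hV
  have herase : ∀ W : Finset (Euc n), W.card ≤ m → ∀ a ∈ W,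
      a ∈ hull0 ((W.erase a : Finset (Euc n)) : Set (Euc n)) → ψ (hull0 (W : Set (Euc n))) = 0 := by
    intro W hW a ha h
    rw [hull0_erase_eq h]
    have := Finset.card_erase_lt_of_mem ha
    exact ih _ (by omega) _ rfl
  have main : ∀ k : ℕ, ∀ W : Finset (Euc n), W.card ≤ m → ∀ g : Euc n → ℝ,
      (W.filter fun v => g v ≠ 0).card = k → (∃ v ∈ W, g v ≠ 0) → ∑ v ∈ W, g v • v = 0 →
      ψ (hull0 (W : Set (Euc n))) = 0 := by
    intro k
    induction k using Nat.strong_induction_on with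
    | _ k ihk =>
    intro W hW g hk hex hsum
    rcases hW.lt_or_eq with hlt | hWm
    · exact ih _ hlt W rfl
    by_cases hsame : ∃ a ∈ W, ∃ b ∈ W, a ≠ b ∧ 0 < g a * g b
    · obtain ⟨a, ha, b, hb, hab, hg⟩ := hsame
      set S := (W.erase a).erase b with hSdef
      have hbS : b ∉ S := by simp [hSdef]
      have haS : a ∉ S := by simp [hSdef]
      have hWS : W = insert a (insert b S) := by
        rw [hSdef, Finset.insert_erase (by simp [hb, hab.symm]), Finset.insert_erase ha]
      have hga : g a ≠ 0 := fun h => by simp [h] at hg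
      have hgb : g b ≠ 0 := fun h => by simp [h] at hg
      have hgab : g a + g b ≠ 0 := fun h => by
        have : g b = - g a := by linarith
        rw [this] at hg; nlinarith [sq_nonneg (g a)]
      have hpos : 0 < g a / (g a + g b) ∧ 0 < g b / (g a + g b) := by
        rcases pos_and_pos_or_neg_and_neg_of_mul_pos hg with ⟨h1, h2⟩ | ⟨h1, h2⟩
        · exact ⟨by positivity, by positivity⟩
        · exact ⟨div_pos_of_neg_of_neg h1 (by linarith), div_pos_of_neg_of_neg h2 (by linarith)⟩
      set w := (g a / (g a + g b)) • a + (g b / (g a + g b)) • b with hw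
      have hwseg : w ∈ openSegment ℝ a b :=
        ⟨_, _, hpos.1, hpos.2, by field_simp, rfl⟩
      have hwsum : (g a + g b) • w = g a • a + g b • b := by
        rw [hw, smul_add, smul_smul, smul_smul, mul_div_cancel₀ _ hgab, mul_div_cancel₀ _ hgab]
      have hwa : w ≠ a := by
        intro h
        have : (g b) • (b - a) = 0 := by
          rw [h] at hwsum
          have : g b • b = g b • a := by
            have := hwsum; rw [add_smul] at this; exact (add_left_cancel this).symm
          rw [smul_sub, this, sub_self]
        rcases smul_eq_zero.1 this with h | h
        · exact hgb h
        · exact hab (sub_eq_zero.1 h).symm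
      have hwb : w ≠ b := by
        intro h
        have : (g a) • (a - b) = 0 := by
          rw [h] at hwsum
          have : g a • a = g a • b := by
            have := hwsum; rw [add_smul] at this; exact (add_right_cancel this).symm
          rw [smul_sub, this, sub_self]
        rcases smul_eq_zero.1 this with h | h
        · exact hga h
        · exact hab (sub_eq_zero.1 h)
      have hcut := hψ.cut hwseg S.finite_toSet
      have hScard : S.card + 2 = m := by
        rw [← hWm, hWS, Finset.card_insert_of_notMem (by simp [hab, haS]),
          Finset.card_insert_of_notMem hbS]
      rw [hWS, Finset.sum_insert (by simp [hab, haS]), Finset.sum_insert hbS] at hsum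
      have piece : ∀ c, c ∉ S → w ≠ c → (S.filter fun v => g v ≠ 0).card + 2 = k →
          ψ (hull0 (insert c (insert w (S : Set (Euc n))))) = 0 := by
        intro c hcS hwc hk2
        by_cases hwS : w ∈ S
        · have := ih (insert c S).card
            (by rw [Finset.card_insert_of_notMem hcS]; omega) (insert c S) rfl
          rw [Set.insert_eq_of_mem (a := w) (s := (S : Set (Euc n))) (by exact_mod_cast hwS)]
          simpa using this
        · have := ihk (k - 1) (by omega) (insert c (insert w S))
            (by
              refine (Finset.card_insert_le _ _).trans ?_
              have := Finset.card_insert_le w S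
              omega)
            (fun v => if v = c then 0 else if v = w then g a + g b else g v)
            (by
              rw [Finset.filter_insert, if_neg (by simp), Finset.filter_insert,
                if_pos (by simpa [hwc] using hgab), Finset.card_insert_of_notMem (by simp [hwS])]
              have : (S.filter fun v =>
                  (if v = c then 0 else if v = w then g a + g b else g v) ≠ 0)
                  = S.filter fun v => g v ≠ 0 := by
                apply Finset.filter_congr
                intro v hv
                have h1 : v ≠ c := fun h => hcS (h ▸ hv)
                have h2 : v ≠ w := fun h => hwS (h ▸ hv)
                rw [if_neg h1, if_neg h2]
              rw [this]; omega)
            ⟨w, by simp, by simpa [hwc] using hgab⟩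
            (by
              rw [Finset.sum_insert (by simp [hwc.symm, hcS]), Finset.sum_insert hwS]
              have : ∑ v ∈ S, (if v = c then 0 else if v = w then g a + g b else g v) • v
                  = ∑ v ∈ S, g v • v := by
                apply Finset.sum_congr rfl
                intro v hv
                have h1 : v ≠ c := fun h => hcS (h ▸ hv)
                have h2 : v ≠ w := fun h => hwS (h ▸ hv)
                rw [if_neg h1, if_neg h2]
              rw [this, if_pos rfl, if_neg hwc, if_pos rfl, hwsum, zero_smul, zero_add, add_assoc]
              exact hsum)
          simpa using this
      have hk2 : (S.filter fun v => g v ≠ 0).card + 2 = k := by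
        rw [← hk, hWS, Finset.filter_insert, if_pos hga, Finset.filter_insert, if_pos hgb,
          Finset.card_insert_of_notMem (by simp [hab, haS]),
          Finset.card_insert_of_notMem (by simp [hbS])]
      have h1 := piece a haS hwa hk2
      have h2 := piece b hbS hwb hk2
      have h3 : ψ (hull0 (insert w (S : Set (Euc n)))) = 0 := by
        have := ih (insert w S).card
          (by have := Finset.card_insert_le w S; omega) (insert w S) rfl
        simpa using this
      have : (W : Set (Euc n)) = insert a (insert b (S : Set (Euc n))) := by
        conv_lhs => rw [hWS]
        simp
      rw [this]
      linarith
    · push Not at hsame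
      obtain ⟨a, ha, hga⟩ := hex
      by_cases hone : ∃ b ∈ W, b ≠ a ∧ g b ≠ 0
      · obtain ⟨b, hb, hba, hgb⟩ := hone
        have hab' : g a * g b < 0 :=
          lt_of_le_of_ne (hsame a ha b hb hba.symm) (mul_ne_zero hga hgb)
        have hrest : ∀ c ∈ W, c ≠ a → c ≠ b → g c = 0 := by
          intro c hc hca hcb
          by_contra hgc
          have h1 : g a * g c < 0 := lt_of_le_of_ne (hsame a ha c hc hca.symm) (mul_ne_zero hga hgc)
          have h2 : g b * g c < 0 := lt_of_le_of_ne (hsame b hb c hc hcb.symm) (mul_ne_zero hgb hgc)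
          have h3 := mul_pos_of_neg_of_neg h1 h2
          have : 0 < (g a * g b) * (g c * g c) := by linarith [h3]
          nlinarith [mul_self_pos.2 hgc]
        have hsum2 : g a • a + g b • b = 0 := by
          rw [← hsum, ← Finset.sum_pair (f := fun v => g v • v) hba.symm]
          apply Finset.sum_subset
          · intro x; simp only [Finset.mem_insert, Finset.mem_singleton]; rintro (rfl | rfl) <;> assumption
          · intro c hc hc'
            simp only [Finset.mem_insert, Finset.mem_singleton, not_or] at hc'
            rw [hrest c hc hc'.1 hc'.2, zero_smul]
        have hae : a = (-(g b) / g a) • b := by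
          have : g a • a = (-(g b)) • b := by
            rw [neg_smul]; exact eq_neg_of_add_eq_zero_left hsum2
          rw [div_eq_inv_mul, mul_smul, ← this, smul_smul, inv_mul_cancel₀ hga, one_smul]
        have hbe : b = (-(g a) / g b) • a := by
          have : g b • b = (-(g a)) • a := by
            rw [neg_smul]; exact eq_neg_of_add_eq_zero_right hsum2
          rw [div_eq_inv_mul, mul_smul, ← this, smul_smul, inv_mul_cancel₀ hgb, one_smul]
        have hpos : 0 < -(g b) / g a := by
          have : -(g b) / g a = -(g a * g b) / (g a * g a) := by field_simp
          rw [this]; exact div_pos (by linarith) (mul_self_pos.2 hga)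
        rcases le_total (-(g b) / g a) 1 with hle | hle
        · refine herase W hW a ha ?_
          have := smul_mem_hull0 (S := ((W.erase a : Finset (Euc n)) : Set (Euc n))) (a := b)
            (by simp [hba, hb]) hpos.le hle
          rwa [← hae] at this
        · refine herase W hW b hb ?_
          have hinv : -(g a) / g b = (-(g b) / g a)⁻¹ := by
            rw [inv_div, div_neg, neg_div]
          have := smul_mem_hull0 (S := ((W.erase b : Finset (Euc n)) : Set (Euc n))) (a := a)
            (μ := -(g a) / g b) (by simp [hba.symm, ha]) (by rw [hinv]; positivity)
            (by rw [hinv]; exact inv_le_one_of_one_le₀ hle)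
          rwa [← hbe] at this
      · push Not at hone
        have : g a • a = 0 := by
          rw [← hsum]
          exact (Finset.sum_eq_single_of_mem (f := fun v => g v • v) a ha fun b hb hba => by
            simp only [hone b hb hba, zero_smul]).symm
        have ha0 : a = 0 := (smul_eq_zero.1 this).resolve_left hga
        exact herase W hW a ha (ha0 ▸ zero_mem_hull0 _)
  rw [Fintype.linearIndependent_iff] at hV
  push Not at hV
  obtain ⟨g, hg, i, hi⟩ := hV
  refine main _ V hm.le (fun v => if h : v ∈ V then g ⟨v, h⟩ else 0) rfl
    ⟨i, i.2, by simpa using hi⟩ ?_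
  rw [← Finset.sum_coe_sort V, ← hg]
  exact Finset.sum_congr rfl fun v _ => by simp

end Hull

/-- The `p`-th power of the support function of the asymmetric `L_p` moment body. -/
def mom {n : ℕ} (p : ℝ) (K : Set (Euc n)) (x : Euc n) : ℝ :=
  ∫ y in K, max ⟪x, y⟫ 0 ^ p

section Operators

variable {n : ℕ}

lemma matVec_apply (A : Matrix (Fin n) (Fin n) ℝ) (x : Euc n) (i : Fin n) :
    matVec A x i = ∑ j, A i j * x j := by
  simp [matVec, Matrix.mulVec, dotProduct]

lemma matVec_mul (A B : Matrix (Fin n) (Fin n) ℝ) (x : Euc n) :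
    matVec (A * B) x = matVec A (matVec B x) := by
  simp [matVec, Matrix.toLpLin_apply]

@[simp] lemma matVec_one (x : Euc n) : matVec (1 : Matrix (Fin n) (Fin n) ℝ) x = x := by
  simp [matVec]

lemma matVec_add (A : Matrix (Fin n) (Fin n) ℝ) (x y : Euc n) :
    matVec A (x + y) = matVec A x + matVec A y := map_add _ _ _

lemma matVec_smul (A : Matrix (Fin n) (Fin n) ℝ) (c : ℝ) (x : Euc n) :
    matVec A (c • x) = c • matVec A x := map_smul _ _ _

lemma matVec_neg (A : Matrix (Fin n) (Fin n) ℝ) (x : Euc n) :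
    matVec A (-x) = -matVec A x := map_neg _ _

lemma continuous_matVec (A : Matrix (Fin n) (Fin n) ℝ) : Continuous (matVec A) :=
  LinearMap.continuous_of_finiteDimensional _

lemma inner_matVec (A : Matrix (Fin n) (Fin n) ℝ) (x y : Euc n) :
    ⟪x, matVec A y⟫ = ⟪matVec Aᵀ x, y⟫ := by
  simp only [PiLp.inner_apply, matVec_apply, Matrix.transpose_apply, Finset.sum_mul,
    RCLike.inner_apply, conj_trivial]
  rw [Finset.sum_comm]
  refine Finset.sum_congr rfl fun i _ => ?_
  rw [Finset.mul_sum]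
  exact Finset.sum_congr rfl fun j _ => by ring

lemma matAct_mul (A B : Matrix (Fin n) (Fin n) ℝ) (K : Set (Euc n)) :
    matAct (A * B) K = matAct A (matAct B K) := by
  unfold matAct
  rw [Set.image_image]
  exact Set.image_congr fun x _ => matVec_mul A B x

@[simp] lemma matAct_one (K : Set (Euc n)) :
    matAct (1 : Matrix (Fin n) (Fin n) ℝ) K = K := by
  have : matAct (1 : Matrix (Fin n) (Fin n) ℝ) K = id '' K :=
    Set.image_congr fun x _ => matVec_one x
  simpa using this

lemma det_toEuclideanLin (A : Matrix (Fin n) (Fin n) ℝ) :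
    LinearMap.det (Matrix.toEuclideanLin A) = A.det := by
  rw [show Matrix.toEuclideanLin A = Matrix.toLin _ _ A from
    congrArg (· A) (Matrix.toLpLin_eq_toLin 2 2), LinearMap.det_toLin]

lemma matVec_injective {A : Matrix (Fin n) (Fin n) ℝ} (hA : A.det ≠ 0) :
    Function.Injective (matVec A) := by
  intro x y h
  have h' := congrArg (matVec A⁻¹) h
  rwa [← matVec_mul, ← matVec_mul, Matrix.nonsing_inv_mul _ (isUnit_iff_ne_zero.2 hA),
    matVec_one, matVec_one] at h'

lemma IsPolytope0.matAct {P : Set (Euc n)} (hP : IsPolytope0 P) (A : Matrix (Fin n) (Fin n) ℝ) :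
    IsPolytope0 (matAct A P) := by
  obtain ⟨V, rfl⟩ := hP.exists_hull0
  rw [matAct_hull0]
  exact isPolytope0_hull0 (V.finite_toSet.image _)

lemma continuous_mom_integrand {p : ℝ} (hp : 0 ≤ p) (x : Euc n) :
    Continuous fun y : Euc n => max ⟪x, y⟫ 0 ^ p :=
  ((continuous_const.inner continuous_id).max continuous_const).rpow_const fun _ => Or.inr hp

lemma mom_matAct {p : ℝ} {K : Set (Euc n)} (hK : IsPolytope0 K)
    {A : Matrix (Fin n) (Fin n) ℝ} (hA : A.det ≠ 0) (x : Euc n) :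
    mom p (matAct A K) x = |A.det| * mom p K (matVec Aᵀ x) := by
  have h := integral_image_eq_integral_abs_det_fderiv_smul (volume : Measure (Euc n))
    (s := K) (f := matVec A)
    (f' := fun _ => LinearMap.toContinuousLinearMap (Matrix.toEuclideanLin A))
    hK.isCompact.isClosed.measurableSet
    (fun y _ => (LinearMap.toContinuousLinearMap
      (Matrix.toEuclideanLin A)).hasFDerivAt.hasFDerivWithinAt)
    (matVec_injective hA).injOn (fun y => max ⟪x, y⟫ 0 ^ p)
  have hd : (LinearMap.toContinuousLinearMap (Matrix.toEuclideanLin A)).det = A.det :=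
    det_toEuclideanLin A
  unfold mom
  rw [show _root_.matAct A K = matVec A '' K from rfl, h]
  simp only [hd, inner_matVec, smul_eq_mul]
  rw [integral_const_mul]

lemma mom_matAct_of_det_eq_zero {p : ℝ} {K : Set (Euc n)}
    {A : Matrix (Fin n) (Fin n) ℝ} (hA : A.det = 0) (x : Euc n) :
    mom p (matAct A K) x = 0 := by
  have : volume (matAct A K) = 0 := by
    unfold matAct
    rw [Measure.addHaar_image_linearMap, det_toEuclideanLin, hA]
    simp
  unfold mom
  rw [Measure.restrict_eq_zero.2 this, integral_zero_measure]

lemma mom_nonneg (p : ℝ) (K : Set (Euc n)) (x : Euc n) : 0 ≤ mom p K x :=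
  integral_nonneg fun _ => Real.rpow_nonneg (le_max_right _ _) _

lemma mPlus_rpow {p : ℝ} (hp : 0 < p) (K : Set (Euc n)) (x : Euc n) :
    mPlus p K x ^ p = mom p K x := by
  unfold mPlus
  rw [one_div]
  exact Real.rpow_inv_rpow (mom_nonneg p K x) hp.ne'

lemma mMinus_rpow {p : ℝ} (hp : 0 < p) (K : Set (Euc n)) (x : Euc n) :
    mMinus p K x ^ p = mom p K (-x) := by
  rw [← mPlus_rpow hp]
  unfold mMinus mPlus
  simp only [inner_neg_left]

lemma isVal_mom {p : ℝ} (hp : 0 ≤ p) (x : Euc n) : IsVal fun K : Set (Euc n) => mom p K x := by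
  intro K L hK hL _ _
  have hc := continuous_mom_integrand hp x
  have hKi := hc.continuousOn.integrableOn_compact (μ := volume) hK.isCompact
  have hLi := hc.continuousOn.integrableOn_compact (μ := volume) hL.isCompact
  have hLm := hL.isCompact.isClosed.measurableSet
  have h1 := setIntegral_union (μ := volume) (f := fun y : Euc n => max ⟪x, y⟫ 0 ^ p)
    (s := K \ L) (t := L) Set.disjoint_sdiff_left hLm (hKi.mono_set Set.sdiff_subset) hLi
  have h2 := integral_inter_add_sdiff (μ := volume) (f := fun y : Euc n => max ⟪x, y⟫ 0 ^ p)
    hLm hKi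
  rw [Set.sdiff_union_self] at h1
  simp only [mom]
  linarith

lemma supp_matAct (A : Matrix (Fin n) (Fin n) ℝ) (K : Set (Euc n)) (x : Euc n) :
    supp (matAct A K) x = supp K (matVec Aᵀ x) := by
  unfold supp matAct
  rw [Set.image_image]
  congr 1
  exact Set.image_congr fun y _ => inner_matVec A x y

lemma IsPolytope0.bddAbove {K : Set (Euc n)} (hK : IsPolytope0 K) (x : Euc n) :
    BddAbove ((fun y => ⟪x, y⟫) '' K) :=
  (hK.isCompact.image (continuous_const.inner continuous_id)).bddAbove

lemma supp_nonneg {K : Set (Euc n)} (hK : IsPolytope0 K) (x : Euc n) : 0 ≤ supp K x :=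
  le_csSup (hK.bddAbove x) ⟨0, hK.2, by simp⟩

lemma isVal_supp (p : ℝ) (x : Euc n) : IsVal fun K : Set (Euc n) => supp K x ^ p := by
  intro K L hK hL hU hI
  have hKne : ((fun y => ⟪x, y⟫) '' K).Nonempty := ⟨_, 0, hK.2, rfl⟩
  have hLne : ((fun y => ⟪x, y⟫) '' L).Nonempty := ⟨_, 0, hL.2, rfl⟩
  have hsup : supp (K ∪ L) x = max (supp K x) (supp L x) := by
    unfold supp
    rw [Set.image_union]
    exact csSup_union (hK.bddAbove x) hKne (hL.bddAbove x) hLne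
  have hinf : supp (K ∩ L) x = min (supp K x) (supp L x) := by
    have hcont : Continuous fun y : Euc n => ⟪x, y⟫ := continuous_const.inner continuous_id
    apply le_antisymm
    · have hne : ((fun y => ⟪x, y⟫) '' (K ∩ L)).Nonempty := ⟨_, 0, hI.2, rfl⟩
      exact le_min (csSup_le_csSup (hK.bddAbove x) hne (Set.image_mono Set.inter_subset_left))
        (csSup_le_csSup (hL.bddAbove x) hne (Set.image_mono Set.inter_subset_right))
    · obtain ⟨k, hk, hke⟩ := hK.isCompact.exists_sSup_image_eq ⟨0, hK.2⟩ hcont.continuousOn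
      obtain ⟨l, hl, hle⟩ := hL.isCompact.exists_sSup_image_eq ⟨0, hL.2⟩ hcont.continuousOn
      have hseg : segment ℝ k l ⊆ K ∪ L :=
        hU.convex.segment_subset (Or.inl hk) (Or.inr hl)
      obtain ⟨z, hz, hzK, hzL⟩ := isPreconnected_closed_iff.1
        (convex_segment (𝕜 := ℝ) k l).isPreconnected K L
        hK.isCompact.isClosed hL.isCompact.isClosed hseg
        ⟨k, left_mem_segment ℝ k l, hk⟩ ⟨l, right_mem_segment ℝ k l, hl⟩
      have hzle : ⟪x, z⟫ ≤ supp (K ∩ L) x := le_csSup (hI.bddAbove x) ⟨z, ⟨hzK, hzL⟩, rfl⟩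
      refine le_trans ?_ hzle
      obtain ⟨a, b, ha, hb, hab, rfl⟩ := hz
      have hk' : supp K x = ⟪x, k⟫ := hke
      have hl' : supp L x = ⟪x, l⟫ := hle
      rw [hk', hl', inner_add_right, inner_smul_right, inner_smul_right]
      have e : min ⟪x, k⟫ ⟪x, l⟫ = a * min ⟪x, k⟫ ⟪x, l⟫ + b * min ⟪x, k⟫ ⟪x, l⟫ := by
        rw [← add_mul, hab, one_mul]
      rw [e]
      gcongr
      · exact min_le_left _ _
      · exact min_le_right _ _
  simp only
  rw [hsup, hinf]
  rcases le_total (supp K x) (supp L x) with h | h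
  · rw [max_eq_right h, min_eq_left h]; ring
  · rw [max_eq_left h, min_eq_right h]

lemma supp_hull0_le {S : Set (Euc n)} {x : Euc n} {c : ℝ} (h0 : 0 ≤ c)
    (h : ∀ s ∈ S, ⟪x, s⟫ ≤ c) : supp (hull0 S) x ≤ c := by
  refine csSup_le (Set.Nonempty.image _ ⟨0, zero_mem_hull0 S⟩) ?_
  rintro _ ⟨z, hz, rfl⟩
  have hconv : Convex ℝ {z : Euc n | ⟪x, z⟫ ≤ c} :=
    convex_halfSpace_le ⟨fun _ _ => inner_add_right _ _ _, fun _ _ => inner_smul_right _ _ _⟩ c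
  have h0' : (0 : Euc n) ∈ {z : Euc n | ⟪x, z⟫ ≤ c} := by
    simpa only [Set.mem_ofPred_eq, inner_zero_right] using h0
  exact convexHull_min (Set.insert_subset h0' h) hconv hz

lemma le_supp_hull0 {S : Set (Euc n)} (hS : S.Finite) {x s : Euc n} (hs : s ∈ S) :
    ⟪x, s⟫ ≤ supp (hull0 S) x :=
  le_csSup ((isPolytope0_hull0 hS).bddAbove x) ⟨s, subset_hull0 S hs, rfl⟩

/-- The functions appearing in the classification are valuations. -/
lemma isVal_combination {p : ℝ} (hp : 0 < p) (a₁ b₁ c₁ c₂ : ℝ) (x : Euc n) :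
    IsVal fun P : Set (Euc n) => c₁ * mPlus p P x ^ p + c₂ * mMinus p P x ^ p
      + a₁ * supp P x ^ p + b₁ * supp P (-x) ^ p := by
  intro K L hK hL hU hI
  have h1 := isVal_mom hp.le x K L hK hL hU hI
  have h2 := isVal_mom hp.le (-x) K L hK hL hU hI
  have h3 := isVal_supp p x K L hK hL hU hI
  have h4 := isVal_supp p (-x) K L hK hL hU hI
  simp only [mPlus_rpow hp, mMinus_rpow hp] at *
  linear_combination c₁ * h1 + c₂ * h2 + a₁ * h3 + b₁ * h4

/-- The functions appearing in the classification are `SL(n)` covariant. -/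
lemma combination_matAct {p : ℝ} (hp : 0 < p) (a₁ b₁ c₁ c₂ : ℝ)
    (φ : Matrix.SpecialLinearGroup (Fin n) ℝ) {P : Set (Euc n)} (hP : IsPolytope0 P) (x : Euc n) :
    c₁ * mPlus p (matAct (φ : Matrix (Fin n) (Fin n) ℝ) P) x ^ p
      + c₂ * mMinus p (matAct (φ : Matrix (Fin n) (Fin n) ℝ) P) x ^ p
      + a₁ * supp (matAct (φ : Matrix (Fin n) (Fin n) ℝ) P) x ^ p
      + b₁ * supp (matAct (φ : Matrix (Fin n) (Fin n) ℝ) P) (-x) ^ p =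
    c₁ * mPlus p P (matVec (φ : Matrix (Fin n) (Fin n) ℝ)ᵀ x) ^ p
      + c₂ * mMinus p P (matVec (φ : Matrix (Fin n) (Fin n) ℝ)ᵀ x) ^ p
      + a₁ * supp P (matVec (φ : Matrix (Fin n) (Fin n) ℝ)ᵀ x) ^ p
      + b₁ * supp P (-matVec (φ : Matrix (Fin n) (Fin n) ℝ)ᵀ x) ^ p := by
  have hd : (φ : Matrix (Fin n) (Fin n) ℝ).det ≠ 0 := by simp
  simp only [mPlus_rpow hp, mMinus_rpow hp, mom_matAct hP hd, supp_matAct, matVec_neg,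
    Matrix.SpecialLinearGroup.det_coe, abs_one, one_mul]

end Operators

/-- The general continuous positively `p`-homogeneous function of one real variable. -/
def homFun (p a b t : ℝ) : ℝ := a * max t 0 ^ p + b * max (-t) 0 ^ p

/-- A function of the largest value of `y` on `I` plus a function of the smallest one. -/
def extremeFun {n : ℕ} (p α β γ δ : ℝ) (I : Finset (Fin n)) (y : Fin n → ℝ) : ℝ :=
  homFun p α β ((I.sup fun i => (y i : WithBot ℝ)).unbotD 0) +
    homFun p γ δ ((I.inf fun i => (y i : WithTop ℝ)).untopD 0)

/-- The functional equations satisfied by the values of a non-negative covariant valuation on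
simplices: `F I D y` is the value at the point with coordinates `y` on the simplex
spanned by the origin and the members with index in `I` of a frame with determinant `D`. -/
structure IsCutFamily {n : ℕ} (p : ℝ) (F : Finset (Fin n) → ℝ → (Fin n → ℝ) → ℝ) : Prop where
  homog : ∀ I D, 0 < D → ∀ c : ℝ, 0 ≤ c → ∀ y, F I D (c • y) = c ^ p * F I D y
  cont : ∀ I D, 0 < D → Continuous (F I D)
  nonneg : ∀ I D, 0 < D → ∀ y, 0 ≤ F I D y
  eq_one : ∀ I, I ≠ Finset.univ → ∀ D, 0 < D → ∀ y, F I D y = F I 1 y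
  congr : ∀ I, I ≠ Finset.univ → ∀ y z, (∀ i ∈ I, y i = z i) → F I 1 y = F I 1 z
  perm : ∀ I, I ≠ Finset.univ → ∀ (σ : Equiv.Perm (Fin n)) y,
    F (I.map σ.toEmbedding) 1 (y ∘ σ.symm) = F I 1 y
  cut : ∀ I D, 0 < D → ∀ i ∈ I, ∀ j ∈ I, i ≠ j → ∀ s t : ℝ, 0 < s → 0 < t → s + t = 1 → ∀ y,
    F I D y + F (I.erase i) (t * D) (Function.update y j (s * y i + t * y j)) =
      F I (s * D) (Function.update y i (s * y i + t * y j)) +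
        F I (t * D) (Function.update y j (s * y i + t * y j))

section HomFun

variable {p : ℝ}

lemma homFun_of_nonneg (hp : 0 < p) (a b : ℝ) {t : ℝ} (ht : 0 ≤ t) :
    homFun p a b t = a * t ^ p := by
  simp [homFun, max_eq_left ht, max_eq_right (neg_nonpos.2 ht), Real.zero_rpow hp.ne']

lemma homFun_of_nonpos (hp : 0 < p) (a b : ℝ) {t : ℝ} (ht : t ≤ 0) :
    homFun p a b t = b * (-t) ^ p := by
  simp [homFun, max_eq_right ht, max_eq_left (neg_nonneg.2 ht), Real.zero_rpow hp.ne']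

lemma homFun_zero (hp : 0 < p) (a b : ℝ) : homFun p a b 0 = 0 := by
  simp [homFun, Real.zero_rpow hp.ne']

/-- A positively homogeneous function of one real variable is determined by two values. -/
lemma eq_homFun (hp : 0 < p) {f : ℝ → ℝ} (hf : ∀ c : ℝ, 0 ≤ c → ∀ t, f (c * t) = c ^ p * f t)
    (t : ℝ) : f t = homFun p (f 1) (f (-1)) t := by
  rcases le_total 0 t with ht | ht
  · rw [homFun_of_nonneg hp _ _ ht, mul_comm, ← hf t ht, mul_one]
  · rw [homFun_of_nonpos hp _ _ ht, mul_comm, ← hf (-t) (by linarith)]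
    congr 1
    ring

end HomFun

section ExtremeFun

variable {n : ℕ} {p : ℝ}

lemma extremeFun_empty (hp : 0 < p) (α β γ δ : ℝ) (y : Fin n → ℝ) :
    extremeFun p α β γ δ ∅ y = 0 := by
  simp [extremeFun, homFun_zero hp]

lemma extremeFun_of_extremes (α β γ δ : ℝ) {I : Finset (Fin n)} {y : Fin n → ℝ} {i j : Fin n}
    (hi : i ∈ I) (hj : j ∈ I) (h : ∀ k ∈ I, y i ≤ y k ∧ y k ≤ y j) :
    extremeFun p α β γ δ I y = homFun p α β (y j) + homFun p γ δ (y i) := by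
  have h1 : (I.sup fun i => (y i : WithBot ℝ)) = (y j : WithBot ℝ) :=
    le_antisymm (Finset.sup_le fun k hk => WithBot.coe_le_coe.2 (h k hk).2)
      (Finset.le_sup (f := fun i => (y i : WithBot ℝ)) hj)
  have h2 : (I.inf fun i => (y i : WithTop ℝ)) = (y i : WithTop ℝ) :=
    le_antisymm (Finset.inf_le (f := fun i => (y i : WithTop ℝ)) hi)
      (Finset.le_inf fun k hk => WithTop.coe_le_coe.2 (h k hk).1)
  rw [extremeFun, h1, h2]
  rfl

lemma extremeFun_cut (α β γ δ : ℝ) {I : Finset (Fin n)} {y : Fin n → ℝ} {i j : Fin n}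
    (hi : i ∈ I) (hj : j ∈ I) (hij : i ≠ j) {w : ℝ}
    (hw : (y i ≤ w ∧ w ≤ y j) ∨ (y j ≤ w ∧ w ≤ y i)) :
    extremeFun p α β γ δ I y + extremeFun p α β γ δ (I.erase i) (Function.update y j w) =
      extremeFun p α β γ δ I (Function.update y i w) +
        extremeFun p α β γ δ I (Function.update y j w) := by
  obtain ⟨S, hiS, hjS, rfl⟩ : ∃ S : Finset (Fin n), i ∉ S ∧ j ∉ S ∧ I = insert i (insert j S) := by
    refine ⟨(I.erase i).erase j, by simp, by simp, ?_⟩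
    rw [Finset.insert_erase (by simp [hj, hij.symm]), Finset.insert_erase hi]
  have hij' : i ∉ insert j S := by simp [hij, hiS]
  have e1 : ∀ (l : Fin n) (v : ℝ), l ∉ S →
      (S.sup fun k => (Function.update y l v k : WithBot ℝ)) = S.sup fun k => (y k : WithBot ℝ) :=
    fun l v hl => Finset.sup_congr rfl fun k hk => by
      have hkl : k ≠ l := fun h => hl (h ▸ hk)
      rw [Function.update_of_ne hkl]
  have e2 : ∀ (l : Fin n) (v : ℝ), l ∉ S →
      (S.inf fun k => (Function.update y l v k : WithTop ℝ)) = S.inf fun k => (y k : WithTop ℝ) :=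
    fun l v hl => Finset.inf_congr rfl fun k hk => by
      have hkl : k ≠ l := fun h => hl (h ▸ hk)
      rw [Function.update_of_ne hkl]
  simp only [extremeFun, Finset.erase_insert hij', Finset.sup_insert, Finset.inf_insert,
    e1 _ _ hiS, e1 _ _ hjS, e2 _ _ hiS, e2 _ _ hjS, Function.update_self,
    Function.update_of_ne hij, Function.update_of_ne hij.symm, ← sup_assoc, ← inf_assoc]
  rcases hw with ⟨h1, h2⟩ | ⟨h1, h2⟩
  · have h3 := h1.trans h2
    rw [sup_eq_right.2 (WithBot.coe_le_coe.2 h3), sup_eq_right.2 (WithBot.coe_le_coe.2 h2),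
      sup_eq_right.2 (WithBot.coe_le_coe.2 h1), inf_eq_left.2 (WithTop.coe_le_coe.2 h3),
      inf_eq_left.2 (WithTop.coe_le_coe.2 h2), inf_eq_left.2 (WithTop.coe_le_coe.2 h1)]
    ring
  · have h3 := h1.trans h2
    rw [sup_eq_left.2 (WithBot.coe_le_coe.2 h3), sup_eq_left.2 (WithBot.coe_le_coe.2 h2),
      sup_eq_left.2 (WithBot.coe_le_coe.2 h1), inf_eq_right.2 (WithTop.coe_le_coe.2 h3),
      inf_eq_right.2 (WithTop.coe_le_coe.2 h2), inf_eq_right.2 (WithTop.coe_le_coe.2 h1)]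
    ring

lemma combo_between {a b s t : ℝ} (hs : 0 < s) (ht : 0 < t) (hst : s + t = 1) :
    (a ≤ s * a + t * b ∧ s * a + t * b ≤ b) ∨ (b ≤ s * a + t * b ∧ s * a + t * b ≤ a) := by
  obtain rfl : s = 1 - t := by linarith
  rcases le_total a b with h | h
  · left; constructor <;> nlinarith
  · right; constructor <;> nlinarith

lemma exists_combo_eq {a b w : ℝ} (h1 : a < w) (h2 : w < b) :
    ∃ s t : ℝ, 0 < s ∧ 0 < t ∧ s + t = 1 ∧ s * a + t * b = w := by
  have : 0 < b - a := by linarith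
  refine ⟨(b - w) / (b - a), (w - a) / (b - a), div_pos (by linarith) this,
    div_pos (by linarith) this, ?_, ?_⟩ <;> field_simp <;> ring

lemma exists_ordered_triple {I : Finset (Fin n)} (hI : 2 < I.card) (y : Fin n → ℝ) :
    ∃ i ∈ I, ∃ j ∈ I, ∃ k ∈ I, i ≠ j ∧ j ≠ k ∧ i ≠ k ∧ y i ≤ y j ∧ y j ≤ y k := by
  obtain ⟨a, b, c, ha, hb, hc, hab, hac, hbc⟩ := Finset.two_lt_card_iff.1 hI
  rcases le_total (y a) (y b) with h1 | h1 <;> rcases le_total (y b) (y c) with h2 | h2 <;>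
    rcases le_total (y a) (y c) with h3 | h3
  · exact ⟨a, ha, b, hb, c, hc, hab, hbc, hac, h1, h2⟩
  · exact ⟨a, ha, b, hb, c, hc, hab, hbc, hac, h1, h2⟩
  · exact ⟨a, ha, c, hc, b, hb, hac, hbc.symm, hab, h3, h2⟩
  · exact ⟨c, hc, a, ha, b, hb, hac.symm, hab, hbc.symm, h3, h1⟩
  · exact ⟨b, hb, a, ha, c, hc, hab.symm, hac, hbc, h1, h3⟩
  · exact ⟨b, hb, c, hc, a, ha, hbc, hac.symm, hab.symm, h2, h3⟩
  · exact ⟨c, hc, b, hb, a, ha, hbc.symm, hab.symm, hac.symm, h2, h1⟩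
  · exact ⟨c, hc, b, hb, a, ha, hbc.symm, hab.symm, hac.symm, h2, h1⟩

end ExtremeFun

section CutFamily

variable {n : ℕ} {p : ℝ} {F : Finset (Fin n) → ℝ → (Fin n → ℝ) → ℝ}

lemma IsCutFamily.empty (hF : IsCutFamily p F) (hp : 0 < p) (hn : 3 ≤ n) (y : Fin n → ℝ) :
    F ∅ 1 y = 0 := by
  have hne : (∅ : Finset (Fin n)) ≠ Finset.univ := fun h => by
    have := congrArg Finset.card h; simp at this; omega
  rw [hF.congr ∅ hne y ((0 : ℝ) • y) (by simp), hF.homog _ _ one_pos 0 le_rfl,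
    Real.zero_rpow hp.ne', zero_mul]

lemma ne_univ_of_card_lt {I : Finset (Fin n)} (h : I.card < n) : I ≠ Finset.univ := by
  rintro rfl; simp at h

lemma IsCutFamily.singleton (hF : IsCutFamily p F) (hp : 0 < p) (hn : 3 ≤ n) :
    ∃ a b : ℝ, 0 ≤ a ∧ 0 ≤ b ∧ ∀ i y, F {i} 1 y = homFun p a b (y i) := by
  let o : Fin n := ⟨0, by omega⟩
  have hne : ∀ i : Fin n, ({i} : Finset (Fin n)) ≠ Finset.univ :=
    fun i => ne_univ_of_card_lt (by simp; omega)
  let f : ℝ → ℝ := fun t => F {o} 1 (fun _ => t)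
  refine ⟨f 1, f (-1), hF.nonneg _ _ one_pos _, hF.nonneg _ _ one_pos _, fun i y => ?_⟩
  rw [← eq_homFun hp (f := f) (fun c hc t => hF.homog _ _ one_pos c hc (fun _ => t))]
  rw [hF.congr _ (hne i) y (fun _ => y i) (by simp)]
  have := hF.perm _ (hne i) (Equiv.swap i o) (fun _ => y i)
  rw [Finset.map_singleton] at this
  simp only [Equiv.coe_toEmbedding, Equiv.swap_apply_left] at this
  exact this.symm

lemma exists_perm_pair {i j k l : Fin n} (hij : i ≠ j) (hkl : k ≠ l) :
    ∃ σ : Equiv.Perm (Fin n), σ i = k ∧ σ j = l := by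
  refine ⟨(Equiv.swap i k).trans (Equiv.swap (Equiv.swap i k j) l), ?_, by simp⟩
  simp only [Equiv.trans_apply, Equiv.swap_apply_left]
  apply Equiv.swap_apply_of_ne_of_ne _ hkl
  intro h
  apply hij
  have : Equiv.swap i k i = Equiv.swap i k j := by rw [Equiv.swap_apply_left]; exact h
  exact (Equiv.swap i k).injective this

lemma IsCutFamily.exists_pair (hF : IsCutFamily p F) (hn : 3 ≤ n) :
    ∃ P : ℝ → ℝ → ℝ, ∀ i j, i ≠ j → ∀ y, F {i, j} 1 y = P (y i) (y j) := by
  let o : Fin n := ⟨0, by omega⟩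
  let o' : Fin n := ⟨1, by omega⟩
  have hoo : o ≠ o' := by simp [o, o']
  have hne : ∀ i j : Fin n, ({i, j} : Finset (Fin n)) ≠ Finset.univ :=
    fun i j => ne_univ_of_card_lt (Finset.card_le_two.trans_lt (by omega))
  refine ⟨fun u v => F {o, o'} 1 (fun k => if k = o then u else v), fun i j hij y => ?_⟩
  obtain ⟨σ, hi, hj⟩ := exists_perm_pair hij hoo
  rw [← hF.perm _ (hne i j) σ y]
  have : ({i, j} : Finset (Fin n)).map σ.toEmbedding = {o, o'} := by
    rw [Finset.map_insert, Finset.map_singleton]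
    simp [hi, hj]
  rw [this]
  apply hF.congr _ (hne o o')
  intro k hk
  simp only [Finset.mem_insert, Finset.mem_singleton] at hk
  rcases hk with rfl | rfl
  · simp [← hi]
  · have h : σ.symm o' = j := by rw [← hj, Equiv.symm_apply_apply]
    simp [hoo.symm, h]

lemma IsCutFamily.pair (hF : IsCutFamily p F) (hp : 0 < p) (hn : 3 ≤ n) {a b : ℝ}
    (hab : ∀ i y, F {i} 1 y = homFun p a b (y i)) :
    ∃ α δ : ℝ, 0 ≤ α ∧ 0 ≤ δ ∧ ∀ i j, i ≠ j → ∀ y, y i ≤ y j →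
      F {i, j} 1 y = homFun p α (b - δ) (y j) + homFun p (a - α) δ (y i) := by
  obtain ⟨P, hP⟩ := hF.exists_pair hn
  let o : Fin n := ⟨0, by omega⟩
  let o' : Fin n := ⟨1, by omega⟩
  have hoo : o ≠ o' := by simp [o, o']
  have hne : ∀ i j : Fin n, ({i, j} : Finset (Fin n)) ≠ Finset.univ :=
    fun i j => ne_univ_of_card_lt (Finset.card_le_two.trans_lt (by omega))
  have hPF : ∀ u v, P u v = F {o, o'} 1 (fun k => if k = o then u else v) := by
    intro u v
    rw [hP o o' hoo]
    simp [hoo.symm]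
  have hhom : ∀ c : ℝ, 0 ≤ c → ∀ u v, P (c * u) (c * v) = c ^ p * P u v := by
    intro c hc u v
    rw [hPF, hPF, ← hF.homog _ _ one_pos c hc]
    congr 1
    ext k
    simp only [Pi.smul_apply, smul_eq_mul]
    split_ifs <;> rfl
  have hcut : ∀ s t : ℝ, 0 < s → 0 < t → s + t = 1 → ∀ u v,
      P u v + homFun p a b (s * u + t * v) = P (s * u + t * v) v + P u (s * u + t * v) := by
    intro s t hs ht hst u v
    have := hF.cut {o, o'} 1 one_pos o (by simp) o' (by simp) hoo s t hs ht hst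
      (fun k => if k = o then u else v)
    rw [hF.eq_one _ (hne _ _) (s * 1) (by linarith), hF.eq_one _ (hne _ _) (t * 1) (by linarith),
      hP _ _ hoo, hP _ _ hoo, hP _ _ hoo, Finset.erase_insert (by simp [hoo]),
      hF.eq_one _ (ne_univ_of_card_lt (by simp; omega)) (t * 1) (by linarith), hab] at this
    simpa [hoo, hoo.symm] using this
  have hbetween : ∀ u w v, u < w → w < v → P u v + homFun p a b w = P w v + P u w := by
    intro u w v h1 h2
    obtain ⟨s, t, hs, ht, hst, rfl⟩ := exists_combo_eq h1 h2
    exact hcut s t hs ht hst u v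
  have hdiag : ∀ u, P u u = homFun p a b u := by
    intro u
    have := hcut (1 / 2) (1 / 2) (by norm_num) (by norm_num) (by norm_num) u u
    rw [show 1 / 2 * u + 1 / 2 * u = u by ring] at this
    linarith
  have hup : ∀ v, 0 ≤ v → P 0 v = P 0 1 * v ^ p := by
    intro v hv
    have := hhom v hv 0 1
    rw [mul_zero, mul_one] at this
    rw [this, mul_comm]
  have hlow : ∀ u, u ≤ 0 → P u 0 = P (-1) 0 * (-u) ^ p := by
    intro u hu
    have := hhom (-u) (by linarith) (-1) 0
    rw [mul_zero, mul_neg_one, neg_neg] at this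
    rw [this, mul_comm]
  refine ⟨P 0 1, P (-1) 0, ?_, ?_, fun i j hij y hy => ?_⟩
  · rw [hPF]; exact hF.nonneg _ _ one_pos _
  · rw [hPF]; exact hF.nonneg _ _ one_pos _
  rw [hP i j hij]
  generalize y i = u at hy ⊢
  generalize y j = v at hy ⊢
  rcases hy.eq_or_lt with rfl | huv
  · rw [hdiag]
    simp only [homFun]; ring
  rcases le_or_gt 0 u with hu | hu
  · have hv : 0 ≤ v := hu.trans huv.le
    rw [homFun_of_nonneg hp _ _ hv, homFun_of_nonneg hp _ _ hu]
    rcases hu.eq_or_lt with rfl | hu'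
    · rw [hup v hv, Real.zero_rpow hp.ne']; ring
    · have := hbetween 0 u v hu' huv
      rw [hup v hv, hup u hu, homFun_of_nonneg hp _ _ hu] at this
      linarith
  · rcases le_or_gt v 0 with hv | hv
    · rw [homFun_of_nonpos hp _ _ hv, homFun_of_nonpos hp _ _ hu.le]
      rcases hv.eq_or_lt with rfl | hv'
      · rw [hlow u hu.le, neg_zero, Real.zero_rpow hp.ne']; ring
      · have := hbetween u v 0 huv hv'
        rw [hlow v hv, hlow u hu.le, homFun_of_nonpos hp _ _ hv] at this
        linarith
    · have := hbetween u 0 v hu hv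
      rw [homFun_of_nonneg hp _ _ hv.le, homFun_of_nonpos hp _ _ hu.le]
      rw [hup v hv.le, hlow u hu.le, homFun_zero hp] at this
      linarith

/-- On lower dimensional simplices the family only depends on the extreme values. -/
lemma IsCutFamily.eq_extremeFun (hF : IsCutFamily p F) (hp : 0 < p) (hn : 3 ≤ n) :
    ∃ a b α δ : ℝ, 0 ≤ a ∧ 0 ≤ b ∧ 0 ≤ α ∧ 0 ≤ δ ∧ ∀ I, I ≠ Finset.univ → ∀ D, 0 < D → ∀ y,
      F I D y = extremeFun p α (b - δ) (a - α) δ I y := by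
  obtain ⟨a, b, ha, hb, hab⟩ := hF.singleton hp hn
  obtain ⟨α, δ, hα, hδ, hpair⟩ := hF.pair hp hn hab
  refine ⟨a, b, α, δ, ha, hb, hα, hδ, ?_⟩
  suffices H : ∀ m, ∀ I : Finset (Fin n), I.card = m → I ≠ Finset.univ → ∀ y,
      F I 1 y = extremeFun p α (b - δ) (a - α) δ I y by
    intro I hI D hD y
    rw [hF.eq_one I hI D hD, H _ I rfl hI]
  intro m
  induction m with
  | zero =>
    intro I hI _ y
    rw [Finset.card_eq_zero.1 hI, hF.empty hp hn, extremeFun_empty hp]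
  | succ m ih =>
    intro I hI hIu y
    have hcut : ∀ i ∈ I, ∀ j ∈ I, i ≠ j → ∀ s t : ℝ, 0 < s → 0 < t → s + t = 1 →
        ∀ z, F I 1 z - extremeFun p α (b - δ) (a - α) δ I z =
          (F I 1 (Function.update z i (s * z i + t * z j)) -
            extremeFun p α (b - δ) (a - α) δ I (Function.update z i (s * z i + t * z j))) +
          (F I 1 (Function.update z j (s * z i + t * z j)) -
            extremeFun p α (b - δ) (a - α) δ I (Function.update z j (s * z i + t * z j))) := by
      intro i hi j hj hij s t hs ht hst z
      have h1 := hF.cut I 1 one_pos i hi j hj hij s t hs ht hst z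
      have h2 := extremeFun_cut (p := p) α (b - δ) (a - α) δ hi hj hij
        (combo_between (a := z i) (b := z j) hs ht hst)
      have hcard : (I.erase i).card = m := by rw [Finset.card_erase_of_mem hi, hI]; rfl
      have hne : I.erase i ≠ Finset.univ := fun h => by
        have := Finset.mem_univ i; rw [← h] at this; simp at this
      rw [hF.eq_one _ hIu (s * 1) (by linarith), hF.eq_one _ hIu (t * 1) (by linarith),
        hF.eq_one _ hne (t * 1) (by linarith), ih _ hcard hne] at h1
      linarith
    rcases Nat.lt_or_ge 2 I.card with h3 | h3
    · have hdiag : ∀ i ∈ I, ∀ j ∈ I, i ≠ j → ∀ z, z i = z j →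
          F I 1 z - extremeFun p α (b - δ) (a - α) δ I z = 0 := by
        intro i hi j hj hij z hz
        have := hcut i hi j hj hij (1 / 2) (1 / 2) (by norm_num) (by norm_num) (by norm_num) z
        rw [← hz, show 1 / 2 * z i + 1 / 2 * z i = z i by ring, Function.update_eq_self, hz,
          Function.update_eq_self] at this
        linarith
      obtain ⟨i, hi, j, hj, k, hk, hij, hjk, hik, h1, h2⟩ := exists_ordered_triple h3 y
      apply sub_eq_zero.1
      rcases h1.eq_or_lt with h1 | h1
      · exact hdiag i hi j hj hij y h1
      rcases h2.eq_or_lt with h2 | h2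
      · exact hdiag j hj k hk hjk y h2
      obtain ⟨s, t, hs, ht, hst, hw⟩ := exists_combo_eq h1 h2
      have := hcut i hi k hk hik s t hs ht hst y
      rw [hw] at this
      rw [this, hdiag i hi j hj hij _ (by simp [hij.symm]),
        hdiag k hk j hj hjk.symm _ (by simp [hjk]), add_zero]
    · rcases Nat.lt_or_ge 1 I.card with h2 | h2
      · obtain ⟨i, j, hij, rfl⟩ := Finset.card_eq_two.1 (le_antisymm h3 h2)
        rcases le_total (y i) (y j) with h | h
        · rw [hpair i j hij y h, extremeFun_of_extremes (i := i) (j := j) _ _ _ _ (by simp)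
            (by simp) (by simp [h])]
        · rw [Finset.pair_comm, hpair j i hij.symm y h,
            extremeFun_of_extremes (i := j) (j := i) _ _ _ _ (by simp) (by simp) (by simp [h])]
      · obtain ⟨i, rfl⟩ := Finset.card_eq_one.1 (le_antisymm h2 (by omega))
        rw [hab, extremeFun_of_extremes (i := i) (j := i) _ _ _ _ (by simp)
            (by simp) (by simp)]
        simp only [homFun]; ring

end CutFamily

section Additive

/-- A function that is additive on the positive half-line and bounded below is non-negative. -/
lemma nonneg_of_additive {f : ℝ → ℝ} (hf : ∀ x y, 0 < x → 0 < y → f (x + y) = f x + f y) {C : ℝ}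
    (hC : ∀ x, 0 < x → C ≤ f x) {x : ℝ} (hx : 0 < x) : 0 ≤ f x := by
  have hmul : ∀ N : ℕ, f ((N + 1 : ℝ) * x) = (N + 1) * f x := by
    intro N
    induction N with
    | zero => simp
    | succ N ih =>
      rw [show ((N + 1 : ℕ) + 1 : ℝ) * x = (N + 1 : ℝ) * x + x by push_cast; ring,
        hf _ _ (by positivity) hx, ih]
      push_cast
      ring
  by_contra! h
  obtain ⟨N, hN⟩ := exists_nat_gt (C / f x)
  have h1 := hC _ (show 0 < (N + 1 : ℝ) * x by positivity)
  rw [hmul] at h1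
  rw [div_lt_iff_of_neg h] at hN
  nlinarith

lemma eq_mul_of_additive {f : ℝ → ℝ} (hf : ∀ x y, 0 < x → 0 < y → f (x + y) = f x + f y) {C : ℝ}
    (hC : ∀ x, 0 < x → C ≤ f x) {x : ℝ} (hx : 0 < x) : f x = x * f 1 := by
  have hadd : ∀ x y, 0 < x → 0 < y →
      f (x + y) - (x + y) * f 1 = (f x - x * f 1) + (f y - y * f 1) := by
    intro x y hx hy
    rw [hf x y hx hy]
    ring
  have hbound : ∀ m : ℕ, ∀ z : ℝ, 0 < z → z ≤ m + 1 → -f 1 ≤ f z - z * f 1 := by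
    intro m
    induction m with
    | zero =>
      intro z hz hz1
      have h0 := nonneg_of_additive hf hC hz
      have h1 := nonneg_of_additive hf hC one_pos
      simp only [Nat.cast_zero, zero_add] at hz1
      nlinarith
    | succ m ih =>
      intro z hz hz1
      by_cases hzm : z ≤ m + 1
      · exact ih z hz hzm
      · push Not at hzm
        have hm : (0 : ℝ) ≤ m := m.cast_nonneg
        have h1 := ih (z - 1) (by linarith) (by push_cast at hz1; linarith)
        have h2 := hadd (z - 1) 1 (by linarith) one_pos
        rw [sub_add_cancel] at h2
        linarith
  have hnonneg : ∀ z, 0 < z → 0 ≤ f z - z * f 1 := fun z hz =>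
    nonneg_of_additive (f := fun z => f z - z * f 1) hadd (C := -f 1) (fun y hy => by
      obtain ⟨m, hm⟩ := exists_nat_ge y
      exact hbound m y hy (by linarith)) hz
  have hnat : ∀ m : ℕ, f (m + 1) - (m + 1) * f 1 = 0 := by
    intro m
    induction m with
    | zero => simp
    | succ m ih =>
      have h2 := hadd (m + 1) 1 (by positivity) one_pos
      push_cast
      rw [h2, ih]
      ring
  obtain ⟨m, hm⟩ := exists_nat_ge x
  have h1 := hadd x (m + 1 - x) hx (by linarith)
  rw [add_sub_cancel, hnat m] at h1
  have h2 := hnonneg x hx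
  have h3 := hnonneg (m + 1 - x) (by linarith)
  linarith

end Additive

section Split

variable {n : ℕ} {p : ℝ}

/-- The functional equation satisfied by `y ↦ ∫ g ⟪y, z⟫ dz` over the standard simplex, which
results from cutting the simplex by a hyperplane containing all but two of its vertices. -/
def IsSplit (r : (Fin n → ℝ) → ℝ) : Prop :=
  ∀ i j, i ≠ j → ∀ s t : ℝ, 0 < s → 0 < t → s + t = 1 → ∀ y,
    r y = s * r (Function.update y i (s * y i + t * y j)) +
      t * r (Function.update y j (s * y i + t * y j))

/-- A maximum principle for solutions of the functional equation. -/
lemma IsSplit.nonpos {r : (Fin n → ℝ) → ℝ} (hr : IsSplit r) (hc : Continuous r)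
    (h0 : ∀ u : ℝ, r (fun _ => u) = 0) (y : Fin n → ℝ) : r y ≤ 0 := by
  obtain ⟨z₀, hz₀, hmax⟩ := (isCompact_closedBall (0 : Fin n → ℝ) ‖y‖).exists_isMaxOn
    ⟨0, by simp⟩ hc.continuousOn
  have hM : ∀ z ∈ Metric.closedBall (0 : Fin n → ℝ) ‖y‖, r z ≤ r z₀ := fun z hz => hmax hz
  have hmem : ∀ z : Fin n → ℝ, z ∈ Metric.closedBall (0 : Fin n → ℝ) ‖y‖ ↔
      ∀ i, |z i| ≤ ‖y‖ := by
    intro z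
    rw [mem_closedBall_zero_iff, pi_norm_le_iff_of_nonneg (norm_nonneg y)]
    rfl
  have hupd : ∀ z ∈ Metric.closedBall (0 : Fin n → ℝ) ‖y‖, ∀ j, ∀ w, |w| ≤ ‖y‖ →
      Function.update z j w ∈ Metric.closedBall (0 : Fin n → ℝ) ‖y‖ := by
    intro z hz j w hw
    rw [hmem] at hz ⊢
    intro k
    by_cases hk : k = j
    · subst hk; simpa using hw
    · rw [Function.update_of_ne hk]; exact hz k
  have hstep : ∀ z ∈ Metric.closedBall (0 : Fin n → ℝ) ‖y‖, r z = r z₀ → ∀ i j, i ≠ j →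
      r (Function.update z j (z i)) = r z₀ := by
    intro z hz hzM i j hij
    have heq : Set.EqOn (fun t : ℝ => r (Function.update z j ((1 - t) * z i + t * z j)))
        (fun _ => r z₀) (Set.Ioo 0 1) := by
      rintro t ⟨ht0, ht1⟩
      have habs : |(1 - t) * z i + t * z j| ≤ ‖y‖ := by
        have hi := abs_le.1 ((hmem z).1 hz i)
        have hj := abs_le.1 ((hmem z).1 hz j)
        rw [abs_le]
        constructor <;> nlinarith
      have h1 := hr i j hij (1 - t) t (by linarith) ht0 (by ring) z
      have h2 := hM _ (hupd z hz i _ habs)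
      have h3 := hM _ (hupd z hz j _ habs)
      rw [hzM] at h1
      apply le_antisymm h3
      nlinarith
    have hcont : Continuous fun t : ℝ => r (Function.update z j ((1 - t) * z i + t * z j)) :=
      hc.comp (continuous_const.update j (by fun_prop))
    have := heq.closure hcont continuous_const (x := 0)
      (by rw [closure_Ioo zero_ne_one]; simp)
    simpa using this
  have hy : r y ≤ r z₀ := hM y (by simp)
  rcases n.eq_zero_or_pos with rfl | hn
  · rw [show y = fun _ => (0 : ℝ) from Subsingleton.elim _ _, h0]
  have hiter : ∀ J : Finset (Fin n), ∃ z ∈ Metric.closedBall (0 : Fin n → ℝ) ‖y‖,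
      r z = r z₀ ∧ ∀ j ∈ J, z j = z ⟨0, hn⟩ := by
    intro J
    induction J using Finset.induction_on with
    | empty => exact ⟨z₀, hz₀, rfl, by simp⟩
    | insert j J hj ih =>
      obtain ⟨z, hz, hzM, hzJ⟩ := ih
      by_cases hj0 : j = ⟨0, hn⟩
      · exact ⟨z, hz, hzM, by simpa [hj0] using hzJ⟩
      · refine ⟨Function.update z j (z ⟨0, hn⟩), hupd z hz j _ ((hmem z).1 hz _),
          hstep z hz hzM _ _ (Ne.symm hj0), fun k hk => ?_⟩
        rw [Function.update_of_ne (Ne.symm hj0)]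
        by_cases hkj : k = j
        · rw [hkj, Function.update_self]
        · rw [Function.update_of_ne hkj]
          exact hzJ k ((Finset.mem_insert.1 hk).resolve_left hkj)
  obtain ⟨z, -, hzM, hzc⟩ := hiter Finset.univ
  rw [← hzM, show z = fun _ => z ⟨0, hn⟩ from funext fun j => hzc j (Finset.mem_univ j), h0] at hy
  exact hy

lemma IsSplit.comp_neg {r : (Fin n → ℝ) → ℝ} (hr : IsSplit r) : IsSplit fun y => r (-y) := by
  intro i j hij s t hs ht hst y
  have h : ∀ k w, -Function.update y k w = Function.update (-y) k (-w) := by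
    intro k w
    ext l
    by_cases hl : l = k
    · subst hl; simp
    · simp [Function.update_of_ne hl]
  simp only [h]
  rw [hr i j hij s t hs ht hst (-y)]
  simp only [Pi.neg_apply, mul_neg, neg_add]

lemma IsSplit.sub_combo {r m₁ m₂ : (Fin n → ℝ) → ℝ} (hr : IsSplit r) (h₁ : IsSplit m₁)
    (h₂ : IsSplit m₂) (a b c : ℝ) : IsSplit fun y => a * r y - (b * m₁ y + c * m₂ y) := by
  intro i j hij s t hs ht hst y
  simp only
  rw [hr i j hij s t hs ht hst y, h₁ i j hij s t hs ht hst y, h₂ i j hij s t hs ht hst y]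
  ring

/-- Uniqueness of homogeneous solutions of the functional equation. -/
lemma IsSplit.eq_combo (hp : 0 < p) {q m : (Fin n → ℝ) → ℝ} (hq : IsSplit q) (hqc : Continuous q)
    (hqh : ∀ c : ℝ, 0 ≤ c → ∀ y, q (c • y) = c ^ p * q y) (hm : IsSplit m) (hmc : Continuous m)
    {m₀ : ℝ} (hm₀ : m₀ ≠ 0) (hmu : ∀ u : ℝ, m (fun _ => u) = m₀ * max u 0 ^ p) (y : Fin n → ℝ) :
    q y = q (fun _ => 1) / m₀ * m y + q (fun _ => -1) / m₀ * m (-y) := by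
  have hu : ∀ u : ℝ, q (fun _ => u) = q (fun _ => 1) / m₀ * m (fun _ => u) +
      q (fun _ => -1) / m₀ * m (-fun _ => u) := by
    intro u
    rw [show (-fun _ => u : Fin n → ℝ) = fun _ => -u from rfl, hmu, hmu,
      eq_homFun (p := p) hp (f := fun u => q fun _ => u) (fun c hc t => hqh c hc _) u, homFun]
    field_simp
  have h1 := (hq.sub_combo hm hm.comp_neg 1 (q (fun _ => 1) / m₀)
    (q (fun _ => -1) / m₀)).nonpos (by fun_prop) (fun u => by rw [hu u]; ring) y
  have h2 := (hq.sub_combo hm hm.comp_neg (-1) (-(q (fun _ => 1) / m₀))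
    (-(q (fun _ => -1) / m₀))).nonpos (by fun_prop) (fun u => by rw [hu u]; ring) y
  linarith

end Split

section CutFamily

variable {n : ℕ} {p : ℝ} {F : Finset (Fin n) → ℝ → (Fin n → ℝ) → ℝ}

/-- On full dimensional simplices the family is an affine function of the determinant. -/
lemma IsCutFamily.exists_split (hF : IsCutFamily p F) (hn : 3 ≤ n) {α β γ δ : ℝ}
    (h : ∀ I, I ≠ Finset.univ → ∀ D, 0 < D → ∀ y, F I D y = extremeFun p α β γ δ I y) :
    ∃ q : (Fin n → ℝ) → ℝ, IsSplit q ∧ Continuous q ∧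
      (∀ c : ℝ, 0 ≤ c → ∀ y, q (c • y) = c ^ p * q y) ∧ (∀ y, 0 ≤ q y) ∧
      ∀ D, 0 < D → ∀ y, F Finset.univ D y = extremeFun p α β γ δ Finset.univ y + D * q y := by
  set e : (Fin n → ℝ) → ℝ := extremeFun p α β γ δ Finset.univ with he
  have hcut : ∀ D, 0 < D → ∀ i j, i ≠ j → ∀ s t : ℝ, 0 < s → 0 < t → s + t = 1 → ∀ y,
      F Finset.univ D y - e y =
      (F Finset.univ (s * D) (Function.update y i (s * y i + t * y j)) -
        e (Function.update y i (s * y i + t * y j))) +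
      (F Finset.univ (t * D) (Function.update y j (s * y i + t * y j)) -
        e (Function.update y j (s * y i + t * y j))) := by
    intro D hD i j hij s t hs ht hst y
    have h1 := hF.cut Finset.univ D hD i (Finset.mem_univ i) j (Finset.mem_univ j) hij s t hs ht
      hst y
    have h2 := extremeFun_cut (p := p) α β γ δ (Finset.mem_univ i) (Finset.mem_univ j) hij
      (combo_between (a := y i) (b := y j) hs ht hst)
    have hne : Finset.univ.erase i ≠ Finset.univ := fun h => by
      have := Finset.mem_univ i; rw [← h] at this; simp at this
    rw [h _ hne _ (mul_pos ht hD)] at h1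
    linarith
  have hdiag : ∀ i j, i ≠ j → ∀ y : Fin n → ℝ, y i = y j → ∀ D, 0 < D →
      F Finset.univ D y - e y = D * (F Finset.univ 1 y - e y) := by
    intro i j hij y hy D hD
    refine eq_mul_of_additive (f := fun D => F Finset.univ D y - e y) (C := -e y) ?_ ?_ hD
    · intro a b ha hb
      have hab : 0 < a + b := by linarith
      have := hcut (a + b) hab i j hij (a / (a + b)) (b / (a + b)) (by positivity)
        (by positivity) (by field_simp) y
      rw [← hy, show a / (a + b) * y i + b / (a + b) * y i = y i by field_simp,
        Function.update_eq_self, hy, Function.update_eq_self,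
        div_mul_cancel₀ _ hab.ne', div_mul_cancel₀ _ hab.ne'] at this
      exact this
    · intro x hx
      have := hF.nonneg Finset.univ x hx y
      linarith
  have hlin : ∀ y : Fin n → ℝ, ∃ c, ∀ D, 0 < D → F Finset.univ D y - e y = D * c := by
    intro y
    obtain ⟨i, -, j, -, k, -, hij, hjk, hik, h1, h2⟩ :=
      exists_ordered_triple (I := (Finset.univ : Finset (Fin n))) (by simp; omega) y
    rcases h1.eq_or_lt with h1 | h1
    · exact ⟨_, hdiag i j hij y h1⟩
    rcases h2.eq_or_lt with h2 | h2
    · exact ⟨_, hdiag j k hjk y h2⟩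
    obtain ⟨s, t, hs, ht, hst, hw⟩ := exists_combo_eq h1 h2
    set z := Function.update y j (y i) with hz
    have hzj : z j = y i := by simp [hz]
    have hzi : z i = y i := by simp [hz, hij]
    have hzk : z k = y k := by simp [hz, hjk.symm]
    have hzy : Function.update z j (y j) = y := by simp [hz]
    set z' := Function.update z k (y j) with hz'
    refine ⟨((F Finset.univ 1 z - e z) - t * (F Finset.univ 1 z' - e z')) / s, fun D hD => ?_⟩
    have hDs : 0 < D / s := by positivity
    have := hcut (D / s) hDs j k hjk s t hs ht hst z
    rw [hzj, hzk, hw, hzy, ← hz', hdiag i j hij z (by rw [hzi, hzj]) _ hDs,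
      hdiag i j hij z' (by simp [hz', hzi, hzj, hik, hjk]) _ (by positivity),
      mul_div_cancel₀ _ hs.ne'] at this
    field_simp at this ⊢
    linarith
  have hq : ∀ D, 0 < D → ∀ y, F Finset.univ D y = e y +
      D * (F Finset.univ 2 y - F Finset.univ 1 y) := by
    intro D hD y
    obtain ⟨c, hc⟩ := hlin y
    have h1 := hc 1 one_pos
    have h2 := hc 2 two_pos
    have h3 := hc D hD
    rw [show F Finset.univ 2 y - F Finset.univ 1 y = c by linarith]
    linarith
  refine ⟨fun y => F Finset.univ 2 y - F Finset.univ 1 y, ?_,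
    (hF.cont _ _ two_pos).sub (hF.cont _ _ one_pos), fun c hc y => ?_, fun y => ?_, hq⟩
  · intro i j hij s t hs ht hst y
    have := hcut 1 one_pos i j hij s t hs ht hst y
    have h1 := hq 1 one_pos y
    have h2 := hq (s * 1) (by linarith) (Function.update y i (s * y i + t * y j))
    have h3 := hq (t * 1) (by linarith) (Function.update y j (s * y i + t * y j))
    linarith
  · simp only [hF.homog _ _ two_pos c hc, hF.homog _ _ one_pos c hc]
    ring
  · refine nonneg_of_additive
      (f := fun D => D * (F Finset.univ 2 y - F Finset.univ 1 y)) (C := -e y) (fun a b _ _ => by ring)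
      (fun D hD => ?_) one_pos |>.trans_eq (one_mul _)
    have := hF.nonneg Finset.univ D hD y
    rw [hq D hD y] at this
    linarith

end CutFamily

/-- The simplex spanned by the origin and the standard basis vectors with index in `I`. -/
def stdSimp {n : ℕ} (I : Finset (Fin n)) : Set (Euc n) :=
  hull0 ((fun i => EuclideanSpace.single i (1 : ℝ)) '' (I : Set (Fin n)))

/-- The identity matrix with one column replaced by `v`. -/
def colMat {n : ℕ} (i : Fin n) (v : Fin n → ℝ) : Matrix (Fin n) (Fin n) ℝ :=
  (1 : Matrix (Fin n) (Fin n) ℝ).updateCol i v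

section Simplex

variable {n : ℕ}

lemma isPolytope0_stdSimp (I : Finset (Fin n)) : IsPolytope0 (stdSimp I) :=
  isPolytope0_hull0 (I.finite_toSet.image _)

lemma matVec_single (A : Matrix (Fin n) (Fin n) ℝ) (i : Fin n) :
    matVec A (EuclideanSpace.single i 1) = WithLp.toLp 2 fun k => A k i := by
  ext k
  simp [matVec_apply]

lemma matAct_stdSimp (A : Matrix (Fin n) (Fin n) ℝ) (I : Finset (Fin n)) :
    matAct A (stdSimp I) = hull0 ((fun i => WithLp.toLp 2 fun k => A k i) '' (I : Set (Fin n))) := by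
  rw [stdSimp, matAct_hull0, Set.image_image]
  simp only [matVec_single]

lemma matAct_stdSimp_congr {A B : Matrix (Fin n) (Fin n) ℝ} {I : Finset (Fin n)}
    (h : ∀ i ∈ I, ∀ k, A k i = B k i) : matAct A (stdSimp I) = matAct B (stdSimp I) := by
  rw [matAct_stdSimp, matAct_stdSimp]
  congr 1
  refine Set.image_congr fun i hi => ?_
  simp only [h i hi]

lemma colMat_self (i : Fin n) (v : Fin n → ℝ) (k : Fin n) : colMat i v k i = v k := by
  simp [colMat]

lemma colMat_ne {i j : Fin n} (h : j ≠ i) (v : Fin n → ℝ) (k : Fin n) :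
    colMat i v k j = (1 : Matrix (Fin n) (Fin n) ℝ) k j := by
  simp [colMat, h]

lemma det_colMat (i : Fin n) (v : Fin n → ℝ) : (colMat i v).det = v i := by
  rw [colMat, ← Matrix.cramer_apply, Matrix.cramer_one]
  rfl

lemma matVec_colMat_transpose (i : Fin n) (v y : Fin n → ℝ) :
    matVec (colMat i v)ᵀ (WithLp.toLp 2 y) =
      WithLp.toLp 2 (Function.update y i (v ⬝ᵥ y)) := by
  ext k
  rw [matVec_apply]
  by_cases hk : k = i
  · subst hk
    simp [colMat_self, dotProduct]
  · simp [colMat_ne hk, hk, Matrix.one_apply]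

lemma matAct_colMat_of_notMem {I : Finset (Fin n)} {j : Fin n} (hj : j ∉ I) (v : Fin n → ℝ) :
    matAct (colMat j v) (stdSimp I) = stdSimp I := by
  conv_rhs => rw [← matAct_one (stdSimp I)]
  refine matAct_stdSimp_congr fun i hi k => colMat_ne ?_ v k
  rintro rfl
  exact hj hi

/-- The point dividing the edge between two standard basis vectors. -/
def edgePoint (i j : Fin n) (s t : ℝ) : Fin n → ℝ := Pi.single i s + Pi.single j t

lemma edgePoint_left {i j : Fin n} (h : i ≠ j) (s t : ℝ) : edgePoint i j s t i = s := by
  simp [edgePoint, h]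

lemma edgePoint_right {i j : Fin n} (h : i ≠ j) (s t : ℝ) : edgePoint i j s t j = t := by
  simp [edgePoint, h.symm]

lemma edgePoint_dotProduct (i j : Fin n) (s t : ℝ) (y : Fin n → ℝ) :
    edgePoint i j s t ⬝ᵥ y = s * y i + t * y j := by
  simp [edgePoint, add_dotProduct]

/-- Cutting a simplex by a hyperplane that contains all but two of its vertices. -/
lemma IsVal.cut_simplex {ψ : Set (Euc n) → ℝ} (hψ : IsVal ψ) (A : Matrix (Fin n) (Fin n) ℝ)
    {I : Finset (Fin n)} {i j : Fin n} (hi : i ∈ I) (hj : j ∈ I) (hij : i ≠ j) {s t : ℝ}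
    (hs : 0 < s) (ht : 0 < t) (hst : s + t = 1) :
    ψ (matAct A (stdSimp I)) + ψ (matAct (A * colMat j (edgePoint i j s t)) (stdSimp (I.erase i))) =
      ψ (matAct (A * colMat i (edgePoint i j s t)) (stdSimp I)) +
        ψ (matAct (A * colMat j (edgePoint i j s t)) (stdSimp I)) := by
  obtain ⟨S, hiS, hjS, rfl⟩ : ∃ S : Finset (Fin n), i ∉ S ∧ j ∉ S ∧ I = insert i (insert j S) := by
    refine ⟨(I.erase i).erase j, by simp, by simp, ?_⟩
    rw [Finset.insert_erase (by simp [hj, hij.symm]), Finset.insert_erase hi]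
  rw [Finset.erase_insert (by simp [hij, hiS])]
  set w := edgePoint i j s t with hw
  have hcol : ∀ l, l ∉ S → ∀ k ∈ (S : Set (Fin n)),
      (fun r => WithLp.toLp 2 fun k => (A * colMat l w) k r : Fin n → Euc n) k =
        (fun r => WithLp.toLp 2 fun k => A k r : Fin n → Euc n) k := by
    intro l hl k hk
    have hkl : k ≠ l := fun h => hl (h ▸ hk)
    ext r
    simp [Matrix.mul_apply, colMat_ne hkl, Matrix.one_apply]
  have hne : ∀ k l, k ≠ l → (WithLp.toLp 2 fun r => (A * colMat l w) r k : Euc n) =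
      WithLp.toLp 2 fun r => A r k := by
    intro k l hkl
    ext r
    simp [Matrix.mul_apply, colMat_ne hkl, Matrix.one_apply]
  have hself : ∀ l, (WithLp.toLp 2 fun r => (A * colMat l w) r l : Euc n) =
      s • (WithLp.toLp 2 fun r => A r i) + t • (WithLp.toLp 2 fun r => A r j) := by
    intro l
    ext r
    have := edgePoint_dotProduct i j s t (A r)
    rw [dotProduct_comm, ← hw] at this
    simp only [Matrix.mul_apply, colMat_self, PiLp.add_apply, PiLp.smul_apply, smul_eq_mul]
    exact this
  have hcut := hψ.cut (a := WithLp.toLp 2 fun k => A k i) (b := WithLp.toLp 2 fun k => A k j)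
    (w := s • (WithLp.toLp 2 fun r => A r i) + t • (WithLp.toLp 2 fun r => A r j))
    ⟨s, t, hs, ht, hst, rfl⟩
    (S := (fun i => WithLp.toLp 2 fun k => A k i) '' (S : Set (Fin n))) (S.finite_toSet.image _)
  simp only [matAct_stdSimp, Finset.coe_insert, Set.image_insert_eq, hself, hne _ _ hij,
    hne _ _ hij.symm, Set.image_congr (hcol _ hiS), Set.image_congr (hcol _ hjS)]
  rw [hcut, add_comm]
  congr 3
  exact Set.insert_comm _ _ _

lemma mom_matAct_stdSimp_of_ne_univ {p : ℝ} {I : Finset (Fin n)} (hI : I ≠ Finset.univ)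
    (A : Matrix (Fin n) (Fin n) ℝ) (x : Euc n) : mom p (matAct A (stdSimp I)) x = 0 := by
  obtain ⟨j, hj⟩ : ∃ j, j ∉ I := by
    by_contra! h
    exact hI (Finset.eq_univ_of_forall h)
  rw [← matAct_colMat_of_notMem hj 0, ← matAct_mul]
  exact mom_matAct_of_det_eq_zero (by rw [Matrix.det_mul, det_colMat]; simp) x

/-- The moment function of the standard simplex. -/
def simpMom (p : ℝ) (y : Fin n → ℝ) : ℝ := mom p (stdSimp Finset.univ) (WithLp.toLp 2 y)

lemma isSplit_simpMom {p : ℝ} (hp : 0 < p) : IsSplit (simpMom (n := n) p) := by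
  intro i j hij s t hs ht hst y
  have h := (isVal_mom hp.le (WithLp.toLp 2 y)).cut_simplex (1 : Matrix (Fin n) (Fin n) ℝ)
    (Finset.mem_univ i) (Finset.mem_univ j) hij hs ht hst
  have hpol := isPolytope0_stdSimp (Finset.univ : Finset (Fin n))
  have hne : Finset.univ.erase i ≠ Finset.univ := fun h => by
    have := Finset.mem_univ i; rw [← h] at this; simp at this
  simp only [one_mul, matAct_one, mom_matAct_stdSimp_of_ne_univ hne] at h
  rw [mom_matAct hpol (by rw [det_colMat, edgePoint_left hij]; exact hs.ne'),
    mom_matAct hpol (by rw [det_colMat, edgePoint_right hij]; exact ht.ne'),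
    det_colMat, det_colMat, edgePoint_left hij, edgePoint_right hij, abs_of_pos hs,
    abs_of_pos ht, matVec_colMat_transpose, matVec_colMat_transpose, edgePoint_dotProduct,
    add_zero] at h
  exact h

lemma continuous_simpMom {p : ℝ} (hp : 0 < p) : Continuous (simpMom (n := n) p) := by
  unfold simpMom mom
  have hc : Continuous fun q : (Fin n → ℝ) × Euc n => max ⟪(WithLp.toLp 2 q.1 : Euc n), q.2⟫ 0 ^ p :=
    ((((PiLp.continuous_toLp 2 _).comp continuous_fst).inner continuous_snd).max
      continuous_const).rpow_const fun _ => Or.inr hp.le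
  exact continuous_parametric_integral_of_continuous (f := fun y z => max ⟪(WithLp.toLp 2 y : Euc n), z⟫ 0 ^ p)
    hc (isPolytope0_stdSimp _).isCompact

lemma simpMom_const (p : ℝ) (u : ℝ) :
    simpMom (n := n) p (fun _ => u) = simpMom (n := n) p (fun _ => 1) * max u 0 ^ p := by
  have hsum : ∀ z ∈ stdSimp (Finset.univ : Finset (Fin n)),
      (0 : ℝ) ≤ ⟪(WithLp.toLp 2 fun _ => 1 : Euc n), z⟫ := by
    have hconv : Convex ℝ {z : Euc n | (0 : ℝ) ≤ ⟪(WithLp.toLp 2 fun _ => 1 : Euc n), z⟫} :=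
      convex_halfSpace_ge ⟨fun _ _ => inner_add_right _ _ _, fun _ _ => inner_smul_right _ _ _⟩ 0
    refine fun z hz => convexHull_min ?_ hconv hz
    rintro _ (rfl | ⟨i, -, rfl⟩)
    · simp
    · simp [EuclideanSpace.inner_single_right]
  unfold simpMom mom
  rw [mul_comm, ← integral_const_mul]
  refine setIntegral_congr_fun (isPolytope0_stdSimp _).isCompact.isClosed.measurableSet
    fun z hz => ?_
  have hu : (WithLp.toLp 2 fun _ => u : Euc n) = u • (WithLp.toLp 2 fun _ => 1 : Euc n) := by
    ext; simp
  have h := hsum z hz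
  simp only
  rw [hu, real_inner_smul_left, ← Real.mul_rpow (le_max_right _ _) (le_max_right _ _),
    max_eq_left h]
  congr 1
  rcases le_total 0 u with hu0 | hu0
  · rw [max_eq_left hu0, max_eq_left (mul_nonneg hu0 h)]
  · rw [max_eq_right hu0, zero_mul, max_eq_right (mul_nonpos_of_nonpos_of_nonneg hu0 h)]

lemma simpMom_one_pos {p : ℝ} (hp : 0 < p) (hn : 0 < n) : 0 < simpMom (n := n) p fun _ => 1 := by
  have hpol := isPolytope0_stdSimp (Finset.univ : Finset (Fin n))
  have hc := continuous_mom_integrand hp.le (WithLp.toLp 2 fun _ => 1 : Euc n)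
  have hn' : (0 : ℝ) < n := by exact_mod_cast hn
  set U : Set (Euc n) := {z | ∀ i, z i ∈ Set.Ioo (0 : ℝ) (1 / n)} with hU
  have hUo : IsOpen U := by
    rw [hU, Set.ofPred_forall]
    exact isOpen_iInter_of_finite fun i => isOpen_Ioo.preimage (by fun_prop)
  have hUne : U.Nonempty := by
    refine ⟨WithLp.toLp 2 fun _ => 1 / (2 * n), fun i => ⟨by simp; positivity, ?_⟩⟩
    simp only
    rw [div_lt_div_iff_of_pos_left one_pos (by positivity) hn']
    linarith
  have hUsub : U ⊆ stdSimp Finset.univ := by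
    intro z hz
    have hle : ∑ i, z i ≤ 1 := by
      calc ∑ i, z i ≤ ∑ _i : Fin n, (1 / n : ℝ) := Finset.sum_le_sum fun i _ => (hz i).2.le
        _ = 1 := by simp; field_simp
    have h := (convex_hull0 ((fun i => EuclideanSpace.single i (1 : ℝ)) ''
      ((Finset.univ : Finset (Fin n)) : Set (Fin n)))).sum_mem (t := Finset.univ)
      (w := fun o : Option (Fin n) => o.elim (1 - ∑ i, z i) z)
      (z := fun o : Option (Fin n) => o.elim 0 fun i => EuclideanSpace.single i 1) ?_ ?_ ?_
    · rw [Fintype.sum_option] at h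
      have hz' : z = (1 - ∑ i, z i) • (0 : Euc n) +
          ∑ i, z i • (EuclideanSpace.single i (1 : ℝ) : Euc n) := by
        ext k
        simp [Pi.single_apply]
      rw [hz']
      exact h
    · rintro (_ | i) _
      · exact sub_nonneg.2 hle
      · exact (hz i).1.le
    · simp [Fintype.sum_option]
    · rintro (_ | i) _
      · exact zero_mem_hull0 _
      · exact subset_hull0 _ ⟨i, by simp, rfl⟩
  unfold simpMom mom
  rw [setIntegral_pos_iff_support_of_nonneg_ae
    (Eventually.of_forall fun _ => Real.rpow_nonneg (le_max_right _ _) _)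
    (hc.continuousOn.integrableOn_compact hpol.isCompact)]
  refine (hUo.measure_pos volume hUne).trans_le (measure_mono fun z hz => ⟨?_, hUsub hz⟩)
  have : 0 < ∑ i, z i :=
    Finset.sum_pos (fun i _ => (hz i).1) ⟨⟨0, hn⟩, Finset.mem_univ _⟩
  rw [Function.mem_support]
  have hin : ⟪(WithLp.toLp 2 fun _ => 1 : Euc n), z⟫ = ∑ i, z i := by
    simp [PiLp.inner_apply]
  rw [hin, max_eq_left this.le]
  exact (Real.rpow_pos_of_pos this p).ne'

end Simplex

/-- A covariant valuation whose values are continuous `p`-homogeneous functions with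
sublinear `p`-th root. -/
structure IsSublinVal {n : ℕ} (p : ℝ) (Φ : Set (Euc n) → Euc n → ℝ) : Prop where
  cont : ∀ P, IsPolytope0 P → Continuous (Φ P)
  homog : ∀ P, IsPolytope0 P → ∀ c : ℝ, 0 ≤ c → ∀ x, Φ P (c • x) = c ^ p * Φ P x
  nonneg : ∀ P, IsPolytope0 P → ∀ x, 0 ≤ Φ P x
  sub : ∀ P, IsPolytope0 P → ∀ x y,
    Φ P (x + y) ^ (1 / p) ≤ Φ P x ^ (1 / p) + Φ P y ^ (1 / p)
  val : ∀ x, IsVal fun P => Φ P x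
  cov : ∀ A : Matrix (Fin n) (Fin n) ℝ, A.det = 1 → ∀ P, IsPolytope0 P → ∀ x,
    Φ (matAct A P) x = Φ P (matVec Aᵀ x)

/-- The values of a covariant valuation on simplices, in the coordinates of the simplex. -/
def simplexValue {n : ℕ} (Φ : Set (Euc n) → Euc n → ℝ) (o : Fin n) (I : Finset (Fin n)) (D : ℝ)
    (y : Fin n → ℝ) : ℝ :=
  Φ (matAct (colMat o (Pi.single o D)) (stdSimp I))
    (matVec ((colMat o (Pi.single o D))⁻¹)ᵀ (WithLp.toLp 2 y))

section Values

variable {n : ℕ} {p : ℝ} {Φ : Set (Euc n) → Euc n → ℝ}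

lemma det_colMat_single (o : Fin n) (D : ℝ) : (colMat o (Pi.single o D)).det = D := by
  simp [det_colMat]

lemma matVec_transpose_inv {A : Matrix (Fin n) (Fin n) ℝ} (hA : A.det ≠ 0) (x : Euc n) :
    matVec Aᵀ (matVec (A⁻¹)ᵀ x) = x := by
  rw [← matVec_mul, ← Matrix.transpose_mul, Matrix.nonsing_inv_mul _ (isUnit_iff_ne_zero.2 hA),
    Matrix.transpose_one, matVec_one]

lemma IsSublinVal.eq_simplexValue (hΦ : IsSublinVal p Φ) (o : Fin n) (I : Finset (Fin n))
    {A : Matrix (Fin n) (Fin n) ℝ} (hA : A.det ≠ 0) (x : Euc n) :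
    Φ (matAct A (stdSimp I)) x = simplexValue Φ o I A.det (matVec Aᵀ x).ofLp := by
  set B := colMat o (Pi.single o A.det) with hB
  have hdet : B.det = A.det := det_colMat_single o A.det
  have hBu : IsUnit B.det := isUnit_iff_ne_zero.2 (hdet ▸ hA)
  have h1 : A = A * B⁻¹ * B := by rw [mul_assoc, Matrix.nonsing_inv_mul _ hBu, mul_one]
  have h2 : (A * B⁻¹).det = 1 := by
    rw [Matrix.det_mul, Matrix.det_nonsing_inv, Ring.inverse_eq_inv', hdet, mul_inv_cancel₀ hA]
  conv_lhs => rw [h1, matAct_mul]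
  rw [hΦ.cov _ h2 _ ((isPolytope0_stdSimp I).matAct B), Matrix.transpose_mul, matVec_mul]
  rfl

lemma IsSublinVal.stdSimp_update (hΦ : IsSublinVal p Φ) (hn : 2 ≤ n) {I : Finset (Fin n)} {j : Fin n}
    (hj : j ∉ I) (y : Fin n → ℝ) (w : ℝ) :
    Φ (stdSimp I) (WithLp.toLp 2 (Function.update y j w)) = Φ (stdSimp I) (WithLp.toLp 2 y) := by
  have hne : ∀ y : Fin n → ℝ, ∀ k, j ≠ k → y k ≠ 0 →
      Φ (stdSimp I) (WithLp.toLp 2 (Function.update y j w)) = Φ (stdSimp I) (WithLp.toLp 2 y) := by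
    intro y k hjk hk
    have h := hΦ.cov (colMat j (edgePoint j k 1 ((w - y j) / y k)))
      (by rw [det_colMat, edgePoint_left hjk]) _ (isPolytope0_stdSimp I) (WithLp.toLp 2 y)
    rw [matAct_colMat_of_notMem hj, matVec_colMat_transpose, edgePoint_dotProduct,
      div_mul_cancel₀ _ hk, one_mul, add_sub_cancel] at h
    exact h.symm
  have : Nontrivial (Fin n) := Fin.nontrivial_iff_two_le.2 hn
  obtain ⟨k, hk⟩ := exists_ne j
  have hc := hΦ.cont _ (isPolytope0_stdSimp I)
  have hc1 : Continuous fun ε : ℝ =>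
      Φ (stdSimp I) (WithLp.toLp 2 (Function.update (Function.update y k ε) j w)) :=
    hc.comp ((PiLp.continuous_toLp 2 _).comp (Continuous.update (f := fun ε : ℝ =>
      Function.update y k ε) (continuous_const.update k continuous_id) j continuous_const))
  have hc2 : Continuous fun ε : ℝ => Φ (stdSimp I) (WithLp.toLp 2 (Function.update y k ε)) :=
    hc.comp ((PiLp.continuous_toLp 2 _).comp (continuous_const.update k continuous_id))
  have h := Continuous.ext_on (dense_compl_singleton (0 : ℝ)) hc1 hc2
    (fun ε hε => hne _ k hk.symm (by simpa using hε))
  simpa using congrFun h (y k)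

lemma IsSublinVal.stdSimp_congr (hΦ : IsSublinVal p Φ) (hn : 2 ≤ n) {I : Finset (Fin n)}
    {y z : Fin n → ℝ} (h : ∀ i ∈ I, y i = z i) :
    Φ (stdSimp I) (WithLp.toLp 2 y) = Φ (stdSimp I) (WithLp.toLp 2 z) := by
  have H : ∀ J : Finset (Fin n), Disjoint J I →
      Φ (stdSimp I) (WithLp.toLp 2 (J.piecewise z y)) = Φ (stdSimp I) (WithLp.toLp 2 y) := by
    intro J
    induction J using Finset.induction_on with
    | empty => simp
    | insert j J hj ih =>
      intro hd
      rw [Finset.disjoint_insert_left] at hd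
      rw [Finset.piecewise_insert, hΦ.stdSimp_update hn hd.1, ih hd.2]
  rw [← H Iᶜ disjoint_compl_left]
  congr 2
  ext i
  by_cases hi : i ∈ I
  · simp [hi, h i hi]
  · simp [hi]

lemma IsSublinVal.matAct_stdSimp_of_ne_univ (hΦ : IsSublinVal p Φ) (hn : 2 ≤ n) {I : Finset (Fin n)}
    (hI : I ≠ Finset.univ) {A : Matrix (Fin n) (Fin n) ℝ} (hA : A.det ≠ 0) (x : Euc n) :
    Φ (matAct A (stdSimp I)) x = Φ (stdSimp I) (matVec Aᵀ x) := by
  obtain ⟨j, hj⟩ : ∃ j, j ∉ I := by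
    by_contra! h
    exact hI (Finset.eq_univ_of_forall h)
  have h := hΦ.cov (A * colMat j (Pi.single j A.det⁻¹))
    (by rw [Matrix.det_mul, det_colMat_single, mul_inv_cancel₀ hA]) _ (isPolytope0_stdSimp I) x
  rw [matAct_mul, matAct_colMat_of_notMem hj, Matrix.transpose_mul, matVec_mul] at h
  rw [h, ← WithLp.toLp_ofLp 2 (matVec Aᵀ x), matVec_colMat_transpose]
  exact hΦ.stdSimp_update hn hj _ _

lemma IsSublinVal.simplexValue_of_ne_univ (hΦ : IsSublinVal p Φ) (hn : 2 ≤ n) (o : Fin n)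
    {I : Finset (Fin n)} (hI : I ≠ Finset.univ) {D : ℝ} (hD : D ≠ 0) (y : Fin n → ℝ) :
    simplexValue Φ o I D y = Φ (stdSimp I) (WithLp.toLp 2 y) := by
  have hdet : (colMat o (Pi.single o D)).det ≠ 0 := by rwa [det_colMat_single]
  rw [simplexValue, hΦ.matAct_stdSimp_of_ne_univ hn hI hdet, matVec_transpose_inv hdet]

/-- The matrix permuting the standard basis vectors. -/
def permMat (σ : Equiv.Perm (Fin n)) : Matrix (Fin n) (Fin n) ℝ :=
  Matrix.of fun k i => if k = σ i then 1 else 0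

lemma det_permMat (σ : Equiv.Perm (Fin n)) : (permMat σ).det = (Equiv.Perm.sign σ : ℤ) := by
  have : permMat σ = σ.symm.toPEquiv.toMatrix := by
    ext k i
    simp only [permMat, Matrix.of_apply, PEquiv.toMatrix_apply,
      Equiv.toPEquiv_apply, Option.mem_some_iff, Equiv.symm_apply_eq]
  rw [this, Matrix.det_permutation, Equiv.Perm.sign_symm]

lemma det_permMat_ne_zero (σ : Equiv.Perm (Fin n)) : (permMat σ).det ≠ 0 := by
  simp [det_permMat]

lemma matVec_permMat_transpose (σ : Equiv.Perm (Fin n)) (y : Fin n → ℝ) :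
    matVec (permMat σ)ᵀ (WithLp.toLp 2 y) = WithLp.toLp 2 (y ∘ σ) := by
  ext k
  simp [matVec_apply, permMat]

lemma matAct_permMat (σ : Equiv.Perm (Fin n)) (I : Finset (Fin n)) :
    matAct (permMat σ) (stdSimp I) = stdSimp (I.map σ.toEmbedding) := by
  rw [matAct_stdSimp, stdSimp, Finset.coe_map, Set.image_image]
  congr 1
  refine Set.image_congr fun i _ => ?_
  ext k
  simp [permMat]

lemma IsSublinVal.isCutFamily (hΦ : IsSublinVal p Φ) (hn : 2 ≤ n) (o : Fin n) :
    IsCutFamily p (simplexValue Φ o) where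
  homog I D _ c hc y := by
    rw [simplexValue, WithLp.toLp_smul, matVec_smul,
      hΦ.homog _ ((isPolytope0_stdSimp I).matAct _) c hc]
    rfl
  cont I D _ := (hΦ.cont _ ((isPolytope0_stdSimp I).matAct _)).comp
    ((continuous_matVec _).comp (PiLp.continuous_toLp 2 _))
  nonneg I D _ y := hΦ.nonneg _ ((isPolytope0_stdSimp I).matAct _) _
  eq_one I hI D hD y := by
    rw [hΦ.simplexValue_of_ne_univ hn o hI hD.ne', hΦ.simplexValue_of_ne_univ hn o hI one_ne_zero]
  congr I hI y z h := by
    rw [hΦ.simplexValue_of_ne_univ hn o hI one_ne_zero,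
      hΦ.simplexValue_of_ne_univ hn o hI one_ne_zero]
    exact hΦ.stdSimp_congr hn h
  perm I hI σ y := by
    have hI' : I.map σ.toEmbedding ≠ Finset.univ := by
      intro h
      have h1 := congrArg Finset.card h
      rw [Finset.card_map, Finset.card_univ] at h1
      exact hI ((Finset.card_eq_iff_eq_univ I).1 h1)
    rw [hΦ.simplexValue_of_ne_univ hn o hI one_ne_zero,
      hΦ.simplexValue_of_ne_univ hn o hI' one_ne_zero, ← matAct_permMat,
      hΦ.matAct_stdSimp_of_ne_univ hn hI (det_permMat_ne_zero σ), matVec_permMat_transpose]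
    simp [Function.comp_assoc]
  cut I D hD i hi j hj hij s t hs ht hst y := by
    obtain ⟨A, hdet⟩ : ∃ A : Matrix (Fin n) (Fin n) ℝ, A.det = D := ⟨_, det_colMat_single o D⟩
    set x := matVec (A⁻¹)ᵀ (WithLp.toLp 2 y) with hx
    have hAx : matVec Aᵀ x = WithLp.toLp 2 y := matVec_transpose_inv (hdet ▸ hD.ne') _
    have h := (hΦ.val x).cut_simplex A hi hj hij hs ht hst
    have hdi : (A * colMat i (edgePoint i j s t)).det = s * D := by
      rw [Matrix.det_mul, det_colMat, edgePoint_left hij, hdet, mul_comm]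
    have hdj : (A * colMat j (edgePoint i j s t)).det = t * D := by
      rw [Matrix.det_mul, det_colMat, edgePoint_right hij, hdet, mul_comm]
    rw [hΦ.eq_simplexValue o I (hdet ▸ hD.ne'),
      hΦ.eq_simplexValue o _ (hdj ▸ (mul_pos ht hD).ne'),
      hΦ.eq_simplexValue o _ (hdi ▸ (mul_pos hs hD).ne'),
      hΦ.eq_simplexValue o _ (hdj ▸ (mul_pos ht hD).ne'), hdi, hdj, hdet,
      Matrix.transpose_mul, Matrix.transpose_mul, matVec_mul, matVec_mul, hAx,
      matVec_colMat_transpose, matVec_colMat_transpose, edgePoint_dotProduct] at h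
    exact h

end Values

section Limits

lemma rpow_le_of_forall_pos {κ a b c a' b' c' : ℝ} (hκ : 0 < κ)
    (h : ∀ D : ℝ, 0 < D → (a + D * a') ^ κ ≤ (b + D * b') ^ κ + (c + D * c') ^ κ) :
    a ^ κ ≤ b ^ κ + c ^ κ := by
  have hcont : ∀ u v : ℝ, Continuous fun D : ℝ => (u + D * v) ^ κ := fun u v =>
    (by fun_prop : Continuous fun D : ℝ => u + D * v).rpow_const fun _ => Or.inr hκ.le
  have hcl := isClosed_le (hcont a a') ((hcont b b').add (hcont c c'))
  have h0 := closure_minimal (s := Set.Ioi (0 : ℝ)) (fun D hD => h D hD) hcl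
  rw [closure_Ioi] at h0
  have h1 : (a + 0 * a') ^ κ ≤ (b + 0 * b') ^ κ + (c + 0 * c') ^ κ := h0 (Set.mem_Ici.2 le_rfl)
  simpa using h1

lemma nonneg_of_forall_pos {a a' : ℝ} (h : ∀ D : ℝ, 0 < D → 0 ≤ a + D * a') : 0 ≤ a := by
  have hcl := isClosed_le (continuous_const (y := (0 : ℝ)))
    (by fun_prop : Continuous fun D : ℝ => a + D * a')
  have h0 := closure_minimal (s := Set.Ioi (0 : ℝ)) (fun D hD => h D hD) hcl
  rw [closure_Ioi] at h0
  have h1 : 0 ≤ a + 0 * a' := h0 (Set.mem_Ici.2 le_rfl)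
  simpa using h1

lemma coeff_nonpos_of_rpow_le {p α γ : ℝ} (hp : 0 < p) (h4 : 0 ≤ α * 4 ^ p + γ * 3 ^ p)
    (h2 : 0 ≤ α * 2 ^ p + γ * 1 ^ p)
    (h : (α * 4 ^ p + γ * 3 ^ p) ^ (1 / p) ≤
      (α * 2 ^ p + γ * 1 ^ p) ^ (1 / p) + (α * 2 ^ p + γ * 1 ^ p) ^ (1 / p)) : γ ≤ 0 := by
  have h' := Real.rpow_le_rpow (Real.rpow_nonneg h4 _) h hp.le
  rw [← two_mul, Real.mul_rpow two_pos.le (Real.rpow_nonneg h2 _), one_div,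
    Real.rpow_inv_rpow h4 hp.ne', Real.rpow_inv_rpow h2 hp.ne', Real.one_rpow,
    show (4 : ℝ) = 2 * 2 by norm_num, Real.mul_rpow two_pos.le two_pos.le] at h'
  have h32 : (2 : ℝ) ^ p < 3 ^ p := Real.rpow_lt_rpow two_pos.le (by norm_num) hp
  by_contra! hγ
  nlinarith

lemma coeff_nonneg_of_rpow_le {p α γ δ : ℝ} (hp : 1 < p) (hα : 0 ≤ α) (hδ : 0 ≤ δ)
    (hαγ : 0 ≤ α + γ)
    (h : ∀ s : ℝ, 0 < s → (α * (1 + s) ^ p) ^ (1 / p) ≤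
      ((α + γ) * s ^ p) ^ (1 / p) + (α + δ * s ^ p) ^ (1 / p)) : 0 ≤ γ := by
  by_contra! hγ
  have hα' : 0 < α := by linarith
  have hp0 : 0 < p := by linarith
  have hκ : 0 < 1 / p := by positivity
  have hgap : 0 < α ^ (1 / p) - (α + γ) ^ (1 / p) :=
    sub_pos.2 (Real.rpow_lt_rpow hαγ (by linarith) hκ)
  set g := α ^ (1 / p) - (α + γ) ^ (1 / p) with hg
  set C := α ^ (1 / p) * (1 / p * (δ / α)) with hC
  have hC0 : 0 ≤ C := by positivity
  have hpow : ∀ s : ℝ, 0 ≤ s → (s ^ p) ^ (1 / p) = s := fun s hs => by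
    rw [one_div, Real.rpow_rpow_inv hs hp0.ne']
  have key : ∀ s : ℝ, 0 < s → g ≤ C * s ^ (p - 1) := by
    intro s hs
    have h1 := h s hs
    have hsp : 0 ≤ s ^ p := by positivity
    rw [Real.mul_rpow hα (by positivity), hpow _ (by linarith), Real.mul_rpow hαγ hsp,
      hpow s hs.le, show α + δ * s ^ p = α * (1 + δ / α * s ^ p) by field_simp,
      Real.mul_rpow hα (by positivity)] at h1
    have h2 : (1 + δ / α * s ^ p) ^ (1 / p) ≤ 1 + 1 / p * (δ / α * s ^ p) :=
      rpow_one_add_le_one_add_mul_self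
        (le_trans (by norm_num) (by positivity : 0 ≤ δ / α * s ^ p)) hκ.le
        ((div_le_one hp0).2 hp.le)
    have h3 := mul_le_mul_of_nonneg_left h2 (Real.rpow_nonneg hα (1 / p))
    have hss : s ^ p = s * s ^ (p - 1) := by
      rw [Real.rpow_sub_one hs.ne']; field_simp
    have h4 : g * s ≤ C * s ^ (p - 1) * s := by
      rw [hg, hC]
      rw [hss] at h1 h3
      nlinarith
    exact le_of_mul_le_mul_right h4 hs
  have hr : 0 < g / (2 * (C + 1)) := by positivity
  have h1 := key _ (Real.rpow_pos_of_pos hr (p - 1)⁻¹)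
  rw [Real.rpow_inv_rpow hr.le (by linarith)] at h1
  have h2 : C * (g / (2 * (C + 1))) < g := by
    rw [mul_div_assoc', div_lt_iff₀ (by positivity)]
    nlinarith
  linarith

end Limits

section Extremes

variable {n : ℕ} {p : ℝ}

lemma extremeFun_of_nonneg (hp : 0 < p) (α β γ δ : ℝ) {I : Finset (Fin n)} {y : Fin n → ℝ}
    {i j : Fin n} (hi : i ∈ I) (hj : j ∈ I) {m M : ℝ} (hm : y i = m) (hM : y j = M) (h0 : 0 ≤ m)
    (h : ∀ k ∈ I, m ≤ y k ∧ y k ≤ M) : extremeFun p α β γ δ I y = α * M ^ p + γ * m ^ p := by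
  subst hm hM
  rw [extremeFun_of_extremes _ _ _ _ hi hj h, homFun_of_nonneg hp _ _ h0,
    homFun_of_nonneg hp _ _ (h0.trans (h i hi).2)]

lemma homFun_neg (a b t : ℝ) : homFun p a b (-t) = homFun p b a t := by
  simp [homFun, add_comm]

lemma extremeFun_neg (α β γ δ : ℝ) (I : Finset (Fin n)) (y : Fin n → ℝ) :
    extremeFun p α β γ δ I (-y) = extremeFun p δ γ β α I y := by
  rcases I.eq_empty_or_nonempty with rfl | hI
  · simp [extremeFun, homFun, add_comm]
  obtain ⟨i, hi, hmin⟩ := I.exists_min_image y hI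
  obtain ⟨j, hj, hmax⟩ := I.exists_max_image y hI
  rw [extremeFun_of_extremes _ _ _ _ hi hj fun k hk => ⟨hmin k hk, hmax k hk⟩,
    extremeFun_of_extremes (y := -y) _ _ _ _ hj hi fun k hk =>
      ⟨neg_le_neg (hmax k hk), neg_le_neg (hmin k hk)⟩]
  simp only [Pi.neg_apply, homFun_neg]
  ring

/-- Subadditivity on triangles. -/
lemma coeff_nonpos_of_triangle (hp : 0 < p) (hn : 3 ≤ n) {α β γ δ : ℝ}
    (hpos : ∀ (I : Finset (Fin n)) y, 0 ≤ extremeFun p α β γ δ I y)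
    (hsub : ∀ (I : Finset (Fin n)) y z, extremeFun p α β γ δ I (y + z) ^ (1 / p) ≤
      extremeFun p α β γ δ I y ^ (1 / p) + extremeFun p α β γ δ I z ^ (1 / p)) : γ ≤ 0 := by
  let i : Fin n := ⟨0, by omega⟩
  let j : Fin n := ⟨1, by omega⟩
  let k : Fin n := ⟨2, by omega⟩
  have hij : i ≠ j := by simp [i, j]
  have hik : i ≠ k := by simp [i, k]
  have hjk : j ≠ k := by simp [j, k]
  let y : Fin n → ℝ := fun l => if l = k then 1 else 2
  let z : Fin n → ℝ := fun l => if l = j then 1 else 2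
  have hy : extremeFun p α β γ δ {i, j, k} y = α * 2 ^ p + γ * 1 ^ p :=
    extremeFun_of_nonneg (i := k) (j := i) hp _ _ _ _ (by simp) (by simp) (by simp [y])
      (by simp [y, hik]) zero_le_one (by simp [y, hik, hjk])
  have hz : extremeFun p α β γ δ {i, j, k} z = α * 2 ^ p + γ * 1 ^ p :=
    extremeFun_of_nonneg (i := j) (j := i) hp _ _ _ _ (by simp) (by simp) (by simp [z])
      (by simp [z, hij]) zero_le_one (by simp [z, hij, hjk.symm])
  have hyz : extremeFun p α β γ δ {i, j, k} (y + z) = α * 4 ^ p + γ * 3 ^ p :=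
    extremeFun_of_nonneg (i := j) (j := i) hp _ _ _ _ (by simp) (by simp)
      (by simp [y, z, hjk]; norm_num) (by simp [y, z, hij, hik]; norm_num) (by norm_num)
      (by simp [y, z, hij, hik, hjk, hjk.symm]; norm_num)
  have h := hsub {i, j, k} y z
  rw [hy, hz, hyz] at h
  exact coeff_nonpos_of_rpow_le hp (hyz ▸ hpos _ _) (hy ▸ hpos _ _) h

/-- Subadditivity on segments. -/
lemma coeff_nonneg_of_segment (hp : 1 < p) (hn : 3 ≤ n) {α β γ δ : ℝ} (hα : 0 ≤ α) (hδ : 0 ≤ δ)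
    (hpos : ∀ (I : Finset (Fin n)) y, 0 ≤ extremeFun p α β γ δ I y)
    (hsub : ∀ (I : Finset (Fin n)) y z, extremeFun p α β γ δ I (y + z) ^ (1 / p) ≤
      extremeFun p α β γ δ I y ^ (1 / p) + extremeFun p α β γ δ I z ^ (1 / p)) : 0 ≤ γ := by
  have hp0 : 0 < p := by linarith
  let i : Fin n := ⟨0, by omega⟩
  let j : Fin n := ⟨1, by omega⟩
  have hij : i ≠ j := by simp [i, j]
  have hy : ∀ s : ℝ, 0 < s → extremeFun p α β γ δ {i, j} (fun _ => s) = (α + γ) * s ^ p := by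
    intro s hs
    rw [extremeFun_of_nonneg (i := i) (j := i) hp0 _ _ _ _ (by simp) (by simp) rfl rfl hs.le
      (by simp)]
    ring
  have hz : ∀ s : ℝ, 0 < s → extremeFun p α β γ δ {i, j} (fun l => if l = i then 1 else -s) =
      α + δ * s ^ p := by
    intro s hs
    rw [extremeFun_of_extremes (i := j) (j := i) _ _ _ _ (by simp) (by simp)
      (by simp [hij.symm]; linarith)]
    simp only [if_true, hij.symm, if_false]
    rw [homFun_of_nonneg hp0 _ _ zero_le_one, homFun_of_nonpos hp0 _ _ (by linarith), neg_neg,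
      Real.one_rpow, mul_one]
  have hyz : ∀ s : ℝ, 0 < s → extremeFun p α β γ δ {i, j}
      ((fun _ => s) + fun l => if l = i then 1 else -s) = α * (1 + s) ^ p := by
    intro s hs
    rw [extremeFun_of_nonneg (i := j) (j := i) (m := 0) (M := 1 + s) hp0 _ _ _ _ (by simp)
      (by simp) (by simp [hij.symm]) (by simp [add_comm]) le_rfl
      (fun k hk => ?_), Real.zero_rpow hp0.ne']
    · ring
    · rcases Finset.mem_insert.1 hk with rfl | hk
      · simp only [Pi.add_apply, if_true]
        constructor <;> linarith
      · rw [Finset.mem_singleton.1 hk]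
        simp only [Pi.add_apply, hij.symm, if_false]
        constructor <;> linarith
  refine coeff_nonneg_of_rpow_le hp hα hδ ?_ fun s hs => ?_
  · have := hpos {i, j} fun _ => 1
    rwa [hy 1 one_pos, Real.one_rpow, mul_one] at this
  · rw [← hy s hs, ← hz s hs, ← hyz s hs]
    exact hsub _ _ _

end Extremes

section Coefficients

variable {n : ℕ} {p : ℝ} {Φ : Set (Euc n) → Euc n → ℝ} {α β γ δ : ℝ}

lemma simplexValue_nonneg (hΦ : IsSublinVal p Φ) (o : Fin n) (I : Finset (Fin n)) (D : ℝ)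
    (y : Fin n → ℝ) : 0 ≤ simplexValue Φ o I D y :=
  hΦ.nonneg _ ((isPolytope0_stdSimp I).matAct _) _

lemma simplexValue_sub (hΦ : IsSublinVal p Φ) (o : Fin n) (I : Finset (Fin n)) (D : ℝ)
    (y z : Fin n → ℝ) : simplexValue Φ o I D (y + z) ^ (1 / p) ≤
      simplexValue Φ o I D y ^ (1 / p) + simplexValue Φ o I D z ^ (1 / p) := by
  simp only [simplexValue, WithLp.toLp_add, matVec_add]
  exact hΦ.sub _ ((isPolytope0_stdSimp I).matAct _) _ _

/-- Reflecting the argument preserves the class of valuations. -/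
lemma IsSublinVal.comp_neg (hΦ : IsSublinVal p Φ) : IsSublinVal p fun P x => Φ P (-x) where
  cont P hP := (hΦ.cont P hP).comp continuous_neg
  homog P hP c hc x := by
    rw [← smul_neg]
    exact hΦ.homog P hP c hc (-x)
  nonneg P hP x := hΦ.nonneg P hP (-x)
  sub P hP x y := by
    rw [neg_add]
    exact hΦ.sub P hP (-x) (-y)
  val x := hΦ.val (-x)
  cov A hA P hP x := by
    rw [hΦ.cov A hA P hP, matVec_neg]

lemma simplexValue_comp_neg (o : Fin n) (I : Finset (Fin n)) (D : ℝ) (y : Fin n → ℝ) :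
    simplexValue (fun P x => Φ P (-x)) o I D y = simplexValue Φ o I D (-y) := by
  simp only [simplexValue, WithLp.toLp_neg, matVec_neg]

/-- The double pyramid with apexes `± A e_l` over a simplex. -/
lemma IsSublinVal.exists_double_pyramid (hΦ : IsSublinVal p Φ) (o : Fin n) {D : ℝ} (hD : 0 < D)
    {i j l : Fin n} (hij : i ≠ j) {J : Finset (Fin n)} (hi : i ∈ J) (hj : j ∈ J) (hl : l ∉ J) :
    ∃ P, IsPolytope0 P ∧ ∀ y, Φ P (matVec ((colMat o (Pi.single o D))⁻¹)ᵀ (WithLp.toLp 2 y)) =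
      simplexValue Φ o (insert l J) D y +
        simplexValue Φ o (insert l J) D (Function.update y l (-y l) ∘ Equiv.swap i j) -
          simplexValue Φ o J D y := by
  set A := colMat o (Pi.single o D) with hA
  have hdet : A.det = D := det_colMat_single o D
  set B := A * colMat l (Pi.single l (-1)) * permMat (Equiv.swap i j) with hB
  have hdetB : B.det = D := by
    rw [hB, Matrix.det_mul, Matrix.det_mul, hdet, det_colMat_single, det_permMat,
      Equiv.Perm.sign_swap hij]
    simp
  let c : Fin n → Euc n := fun m => WithLp.toLp 2 fun k => A k m
  have hJ : matAct A (stdSimp J) = hull0 (c '' J) := matAct_stdSimp A J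
  have hJ' : matAct A (stdSimp (insert l J)) = hull0 (insert (c l) (c '' J)) := by
    rw [matAct_stdSimp, Finset.coe_insert, Set.image_insert_eq]
  have hmap : (insert l J).map (Equiv.swap i j).toEmbedding = insert l J := by
    refine Finset.eq_of_subset_of_card_le (fun m hm => ?_) (by rw [Finset.card_map])
    obtain ⟨k, hk, rfl⟩ := Finset.mem_map.1 hm
    by_cases h1 : k = i
    · subst h1
      simp [hj]
    by_cases h2 : k = j
    · subst h2
      simp [hi]
    simpa [Equiv.swap_apply_of_ne_of_ne h1 h2] using hk
  have hBJ : matAct B (stdSimp (insert l J)) = hull0 (insert (-c l) (c '' J)) := by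
    rw [hB, matAct_mul, matAct_permMat, hmap, matAct_stdSimp, Finset.coe_insert,
      Set.image_insert_eq]
    congr 2
    · ext k
      simp [c, Matrix.mul_apply, colMat_self, Pi.single_apply]
    · refine Set.image_congr fun m hm => ?_
      have hml : m ≠ l := fun h => hl (h ▸ hm)
      ext k
      simp [c, Matrix.mul_apply, colMat_ne hml, Matrix.one_apply]
  have hfin : (c '' (J : Set (Fin n))).Finite := J.finite_toSet.image _
  have h0 : ∀ S : Set (Euc n), hull0 (insert 0 S) = hull0 S := fun S => by
    simp [hull0]
  have hmid : (0 : Euc n) ∈ openSegment ℝ (c l) (-c l) :=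
    ⟨1 / 2, 1 / 2, by norm_num, by norm_num, by norm_num, by simp⟩
  refine ⟨hull0 (insert (c l) (insert (-c l) (c '' J))),
    isPolytope0_hull0 ((hfin.insert _).insert _), fun y => ?_⟩
  set x := matVec (A⁻¹)ᵀ (WithLp.toLp 2 y) with hx
  have hAx : matVec Aᵀ x = WithLp.toLp 2 y := matVec_transpose_inv (hdet ▸ hD.ne') _
  have h := (hΦ.val x).cut hmid hfin
  rw [Set.insert_comm (c l) 0, Set.insert_comm (-c l) 0, h0, h0, h0, ← hJ, ← hJ', ← hBJ,
    hΦ.eq_simplexValue o J (hdet ▸ hD.ne'), hΦ.eq_simplexValue o _ (hdet ▸ hD.ne'),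
    hΦ.eq_simplexValue o _ (hdetB ▸ hD.ne'), hdet, hdetB, hB, Matrix.transpose_mul,
    Matrix.transpose_mul, matVec_mul, matVec_mul, hAx, matVec_colMat_transpose,
    matVec_permMat_transpose, single_dotProduct, neg_one_mul] at h
  exact eq_sub_of_add_eq h

lemma IsSublinVal.coeff_nonneg_of_double_pyramid {Φ : Set (Euc n) → Euc n → ℝ}
    (hΦ : IsSublinVal 1 Φ) (hn : 4 ≤ n) (o : Fin n)
    (hE : ∀ I, ∃ q : (Fin n → ℝ) → ℝ, ∀ D, 0 < D → ∀ y,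
      simplexValue Φ o I D y = extremeFun 1 α β γ δ I y + D * q y) : 0 ≤ γ := by
  let i : Fin n := ⟨0, by omega⟩
  let j : Fin n := ⟨1, by omega⟩
  let k : Fin n := ⟨2, by omega⟩
  let l : Fin n := ⟨3, by omega⟩
  have hij : i ≠ j := by simp [i, j]
  have hik : i ≠ k := by simp [i, k]
  have hjk : j ≠ k := by simp [j, k]
  have hil : i ≠ l := by simp [i, l]
  have hjl : j ≠ l := by simp [j, l]
  have hkl : k ≠ l := by simp [k, l]
  let v : ℝ → ℝ → ℝ → Fin n → ℝ := fun a b c m =>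
    if m = i then a else if m = j then b else if m = k then c else 0
  have hvi : ∀ a b c, v a b c i = a := fun a b c => if_pos rfl
  have hvj : ∀ a b c, v a b c j = b := fun a b c => by simp [v, hij.symm]
  have hvk : ∀ a b c, v a b c k = c := fun a b c => by simp [v, hik.symm, hjk.symm]
  have hvl : ∀ a b c, v a b c l = 0 := fun a b c => by simp [v, hil.symm, hjl.symm, hkl.symm]
  have hswap : ∀ a b c, Function.update (v a b c) l (-v a b c l) ∘ Equiv.swap i j = v b a c := by
    intro a b c
    rw [hvl, neg_zero, ← hvl a b c, Function.update_eq_self]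
    ext m
    by_cases h1 : m = i
    · subst h1
      simp [hvi, hvj]
    by_cases h2 : m = j
    · subst h2
      simp [hvi, hvj]
    simp [Equiv.swap_apply_of_ne_of_ne h1 h2, v, h1, h2]
  obtain ⟨q, hq⟩ := hE {i, j, k}
  obtain ⟨r, hr⟩ := hE (insert l {i, j, k})
  have hbase : ∀ {a b c m M : ℝ} {s t : Fin n}, s ∈ ({i, j, k} : Finset (Fin n)) →
      t ∈ ({i, j, k} : Finset (Fin n)) → v a b c s = m → v a b c t = M → 0 ≤ m →
      (m ≤ a ∧ a ≤ M) → (m ≤ b ∧ b ≤ M) → (m ≤ c ∧ c ≤ M) →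
      extremeFun 1 α β γ δ {i, j, k} (v a b c) = α * M + γ * m ∧
      extremeFun 1 α β γ δ (insert l {i, j, k}) (v a b c) = α * M := by
    intro a b c m M s t hs ht hm hM h0 ha hb hc
    constructor
    · rw [extremeFun_of_nonneg one_pos _ _ _ _ hs ht hm hM h0, Real.rpow_one, Real.rpow_one]
      simp [hvi, hvj, hvk, ha, hb, hc]
    · rw [extremeFun_of_nonneg one_pos _ _ _ _ (Finset.mem_insert_self _ _)
        (Finset.mem_insert_of_mem ht) (hvl a b c) hM le_rfl, Real.rpow_one, Real.rpow_one,
        mul_zero, add_zero]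
      have : 0 ≤ M := h0.trans (ha.1.trans ha.2)
      simp [hvi, hvj, hvk, hvl, ha, hb, hc, h0.trans ha.1, h0.trans hb.1, h0.trans hc.1, this]
  have key : ∀ D : ℝ, 0 < D → ∃ P, IsPolytope0 P ∧ ∀ a b c,
      Φ P (matVec ((colMat o (Pi.single o D))⁻¹)ᵀ (WithLp.toLp 2 (v a b c))) =
        extremeFun 1 α β γ δ (insert l {i, j, k}) (v a b c) +
          extremeFun 1 α β γ δ (insert l {i, j, k}) (v b a c) -
          extremeFun 1 α β γ δ {i, j, k} (v a b c) +
        D * (r (v a b c) + r (v b a c) - q (v a b c)) := by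
    intro D hD
    obtain ⟨P, hP, h⟩ := hΦ.exists_double_pyramid o hD hij (J := {i, j, k}) (l := l) (by simp)
      (by simp) (by simp [hil.symm, hjl.symm, hkl.symm])
    refine ⟨P, hP, fun a b c => ?_⟩
    rw [h, hswap, hq D hD, hr D hD, hr D hD]
    ring
  have hadd : v 4 3 3 = v 2 2 1 + v 2 1 2 := by
    ext m
    simp only [v, Pi.add_apply]
    split_ifs <;> norm_num
  have hlim := rpow_le_of_forall_pos (κ := 1) one_pos (a := α * 4 + α * 4 - (α * 4 + γ * 3))
    (b := α * 2 + α * 2 - (α * 2 + γ * 1)) (c := α * 2 + α * 2 - (α * 2 + γ * 1))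
    (a' := r (v 4 3 3) + r (v 3 4 3) - q (v 4 3 3))
    (b' := r (v 2 2 1) + r (v 2 2 1) - q (v 2 2 1))
    (c' := r (v 2 1 2) + r (v 1 2 2) - q (v 2 1 2)) fun D hD => by
      obtain ⟨P, hP, h⟩ := key D hD
      have h1 := hΦ.sub P hP
        (matVec ((colMat o (Pi.single o D))⁻¹)ᵀ (WithLp.toLp 2 (v 2 2 1)))
        (matVec ((colMat o (Pi.single o D))⁻¹)ᵀ (WithLp.toLp 2 (v 2 1 2)))
      rw [← matVec_add, ← WithLp.toLp_add, ← hadd, h, h, h, one_div_one] at h1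
      obtain ⟨e1, e2⟩ := hbase (a := 4) (b := 3) (c := 3) (s := j) (t := i) (by simp) (by simp)
        (hvj _ _ _) (hvi _ _ _) (by norm_num) (by norm_num) (by norm_num) (by norm_num)
      obtain ⟨-, e3⟩ := hbase (a := 3) (b := 4) (c := 3) (s := i) (t := j) (by simp) (by simp)
        (hvi _ _ _) (hvj _ _ _) (by norm_num) (by norm_num) (by norm_num) (by norm_num)
      obtain ⟨e4, e5⟩ := hbase (a := 2) (b := 2) (c := 1) (s := k) (t := i) (by simp) (by simp)
        (hvk _ _ _) (hvi _ _ _) (by norm_num) (by norm_num) (by norm_num) (by norm_num)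
      obtain ⟨e6, e7⟩ := hbase (a := 2) (b := 1) (c := 2) (s := j) (t := i) (by simp) (by simp)
        (hvj _ _ _) (hvi _ _ _) (by norm_num) (by norm_num) (by norm_num) (by norm_num)
      obtain ⟨-, e8⟩ := hbase (a := 1) (b := 2) (c := 2) (s := i) (t := j) (by simp) (by simp)
        (hvi _ _ _) (hvj _ _ _) (by norm_num) (by norm_num) (by norm_num) (by norm_num)
      rwa [e1, e2, e3, e4, e5, e6, e7, e8] at h1
  simp only [Real.rpow_one] at hlim
  linarith

lemma IsSublinVal.coeff_eq_zero (hΦ : IsSublinVal p Φ) (hnp : (3 ≤ n ∧ 1 < p) ∨ (4 ≤ n ∧ p = 1))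
    (o : Fin n) (hα : 0 ≤ α) (hδ : 0 ≤ δ)
    (hE : ∀ I, ∃ q : (Fin n → ℝ) → ℝ, ∀ D, 0 < D → ∀ y,
      simplexValue Φ o I D y = extremeFun p α β γ δ I y + D * q y) : γ = 0 := by
  have hp : 0 < p := by rcases hnp with h | h <;> linarith
  have hpos : ∀ (I : Finset (Fin n)) y, 0 ≤ extremeFun p α β γ δ I y := fun I y => by
    obtain ⟨q, hq⟩ := hE I
    exact nonneg_of_forall_pos (a' := q y) fun D hD => hq D hD y ▸ simplexValue_nonneg hΦ o I D y
  have hsub : ∀ (I : Finset (Fin n)) y z, extremeFun p α β γ δ I (y + z) ^ (1 / p) ≤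
      extremeFun p α β γ δ I y ^ (1 / p) + extremeFun p α β γ δ I z ^ (1 / p) := fun I y z => by
    obtain ⟨q, hq⟩ := hE I
    refine rpow_le_of_forall_pos (by positivity) (a' := q (y + z)) (b' := q y) (c' := q z)
      fun D hD => ?_
    rw [← hq D hD, ← hq D hD, ← hq D hD]
    exact simplexValue_sub hΦ o I D y z
  refine le_antisymm (coeff_nonpos_of_triangle hp (by omega) hpos hsub) ?_
  rcases hnp with ⟨hn, hp1⟩ | ⟨hn, rfl⟩
  · exact coeff_nonneg_of_segment hp1 hn hα hδ hpos hsub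
  · exact hΦ.coeff_nonneg_of_double_pyramid hn o hE

/-- The values of a sublinear valuation on simplices. -/
lemma IsSublinVal.exists_eq (hΦ : IsSublinVal p Φ) (hnp : (3 ≤ n ∧ 1 < p) ∨ (4 ≤ n ∧ p = 1))
    (o : Fin n) : ∃ α δ : ℝ, ∃ q : (Fin n → ℝ) → ℝ, 0 ≤ α ∧ 0 ≤ δ ∧
      IsSplit q ∧ Continuous q ∧ (∀ c : ℝ, 0 ≤ c → ∀ y, q (c • y) = c ^ p * q y) ∧
      (∀ y, 0 ≤ q y) ∧ ∀ I, ∀ D, 0 < D → ∀ y, simplexValue Φ o I D y =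
        extremeFun p α 0 0 δ I y + if I = Finset.univ then D * q y else 0 := by
  have hp : 0 < p := by rcases hnp with h | h <;> linarith
  have hn : 3 ≤ n := by omega
  have hF := hΦ.isCutFamily (by omega) o
  obtain ⟨a, b, α, δ, -, -, hα, hδ, h⟩ := hF.eq_extremeFun hp hn
  obtain ⟨q, hsplit, hcont, hhom, hnonneg, hq⟩ := hF.exists_split hn h
  have hE : ∀ I, ∀ D, 0 < D → ∀ y, simplexValue Φ o I D y =
      extremeFun p α (b - δ) (a - α) δ I y + if I = Finset.univ then D * q y else 0 := by
    intro I D hD y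
    split_ifs with hI
    · rw [hI, hq D hD]
    · rw [h I hI D hD, add_zero]
  have hE1 : ∀ I, ∃ q : (Fin n → ℝ) → ℝ, ∀ D, 0 < D → ∀ y,
      simplexValue Φ o I D y = extremeFun p α (b - δ) (a - α) δ I y + D * q y := fun I =>
    ⟨fun y => if I = Finset.univ then q y else 0, fun D hD y => by rw [hE I D hD, mul_ite, mul_zero]⟩
  have hE2 : ∀ I, ∃ q : (Fin n → ℝ) → ℝ, ∀ D, 0 < D → ∀ y,
      simplexValue (fun P x => Φ P (-x)) o I D y =
        extremeFun p δ (a - α) (b - δ) α I y + D * q y := fun I => by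
    obtain ⟨r, hr⟩ := hE1 I
    exact ⟨fun y => r (-y), fun D hD y => by
      rw [simplexValue_comp_neg, hr D hD, extremeFun_neg]⟩
  have hγ := hΦ.coeff_eq_zero hnp o hα hδ hE1
  have hβ := hΦ.comp_neg.coeff_eq_zero hnp o hδ hα hE2
  rw [hγ, hβ] at hE
  exact ⟨α, δ, q, hα, hδ, hsplit, hcont, hhom, hnonneg, hE⟩

end Coefficients

section Assembly

variable {n : ℕ} {p : ℝ}

lemma supp_stdSimp {I : Finset (Fin n)} {j : Fin n} (hj : j ∈ I) {x : Euc n}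
    (h : ∀ k ∈ I, x k ≤ x j) : supp (stdSimp I) x = max (x j) 0 := by
  have hin : ∀ k, ⟪x, EuclideanSpace.single k (1 : ℝ)⟫ = x k := fun k => by
    simp [EuclideanSpace.inner_single_right]
  refine le_antisymm (supp_hull0_le (le_max_right _ _) ?_)
    (max_le ?_ (supp_nonneg (isPolytope0_stdSimp I) x))
  · rintro _ ⟨k, hk, rfl⟩
    rw [hin]
    exact (h k hk).trans (le_max_left _ _)
  · rw [← hin j]
    exact le_supp_hull0 (I.finite_toSet.image _) (Set.mem_image_of_mem _ hj)

lemma supp_stdSimp_empty (x : Euc n) : supp (stdSimp (∅ : Finset (Fin n))) x = 0 := by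
  refine le_antisymm (supp_hull0_le le_rfl ?_) (supp_nonneg (isPolytope0_stdSimp _) x)
  simp

lemma extremeFun_eq_supp (hp : 0 < p) (α δ : ℝ) (I : Finset (Fin n)) (x : Euc n) :
    extremeFun p α 0 0 δ I x.ofLp = α * supp (stdSimp I) x ^ p + δ * supp (stdSimp I) (-x) ^ p := by
  rcases I.eq_empty_or_nonempty with rfl | hI
  · simp [extremeFun, homFun, supp_stdSimp_empty, Real.zero_rpow hp.ne']
  obtain ⟨i, hi, hmin⟩ := I.exists_min_image x.ofLp hI
  obtain ⟨j, hj, hmax⟩ := I.exists_max_image x.ofLp hI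
  rw [extremeFun_of_extremes _ _ _ _ hi hj fun k hk => ⟨hmin k hk, hmax k hk⟩,
    supp_stdSimp hj hmax, supp_stdSimp hi fun k hk => neg_le_neg (hmin k hk)]
  simp [homFun]

/-- Linearly independent vectors are among the columns of a matrix with positive determinant. -/
lemma exists_matAct_stdSimp (hn : 2 ≤ n) {V : Finset (Euc n)}
    (hV : LinearIndependent ℝ ((↑) : V → Euc n)) : ∃ (A : Matrix (Fin n) (Fin n) ℝ)
      (I : Finset (Fin n)), 0 < A.det ∧ hull0 (V : Set (Euc n)) = matAct A (stdSimp I) := by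
  classical
  have hV' : LinearIndepOn ℝ id (V : Set (Euc n)) := hV
  let b := Module.Basis.extend hV'
  have : Fintype (hV'.extend (Set.subset_univ _)) := FiniteDimensional.fintypeBasisIndex b
  have hcard : Fintype.card (hV'.extend (Set.subset_univ _)) = n := by
    rw [← Module.finrank_eq_card_basis b, finrank_euclideanSpace_fin]
  let c := b.reindex (Fintype.equivFinOfCardEq hcard)
  have hVc : (V : Set (Euc n)) ⊆ Set.range c := by
    rw [Module.Basis.range_reindex, Module.Basis.range_extend]
    exact hV'.subset_extend _
  let A : Matrix (Fin n) (Fin n) ℝ := Matrix.of fun k i => c i k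
  have hA : A.det ≠ 0 := by
    rw [← isUnit_iff_ne_zero, ← Matrix.isUnit_iff_isUnit_det,
      ← Matrix.linearIndependent_cols_iff_isUnit]
    exact c.linearIndependent.map' (WithLp.linearEquiv 2 ℝ (Fin n → ℝ)).toLinearMap
      (LinearEquiv.ker _)
  let I : Finset (Fin n) := Finset.univ.filter fun i => c i ∈ V
  have hI : hull0 (V : Set (Euc n)) = matAct A (stdSimp I) := by
    rw [matAct_stdSimp]
    congr 1
    ext v
    constructor
    · intro hv
      obtain ⟨i, rfl⟩ := hVc hv
      exact ⟨i, by simpa [I] using hv, rfl⟩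
    · rintro ⟨i, hi, rfl⟩
      exact (Finset.mem_filter.1 hi).2
  rcases hA.lt_or_gt with h | h
  · let σ : Equiv.Perm (Fin n) := Equiv.swap ⟨0, by omega⟩ ⟨1, by omega⟩
    refine ⟨A * permMat σ, I.map σ.symm.toEmbedding, ?_, ?_⟩
    · rw [Matrix.det_mul, det_permMat, Equiv.Perm.sign_swap (by simp)]
      simpa using h
    · rw [matAct_mul, matAct_permMat, Finset.map_map, hI]
      congr 2
      ext i
      simp
  · exact ⟨A, I, h, hI⟩

lemma IsSublinVal.exists_combination {Φ : Set (Euc n) → Euc n → ℝ} (hΦ : IsSublinVal p Φ)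
    (hnp : (3 ≤ n ∧ 1 < p) ∨ (4 ≤ n ∧ p = 1)) :
    ∃ a₁ b₁ c₁ c₂ : ℝ, 0 ≤ a₁ ∧ 0 ≤ b₁ ∧ 0 ≤ c₁ ∧ 0 ≤ c₂ ∧
      ∀ P : Set (Euc n), IsPolytope0 P → ∀ x : Euc n,
        Φ P x = c₁ * mPlus p P x ^ p + c₂ * mMinus p P x ^ p
          + a₁ * supp P x ^ p + b₁ * supp P (-x) ^ p := by
  have hp : 0 < p := by rcases hnp with h | h <;> linarith
  have hn : 3 ≤ n := by omega
  let o : Fin n := ⟨0, by omega⟩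
  obtain ⟨α, δ, q, hα, hδ, hsplit, hcont, hhom, hnonneg, hq⟩ := hΦ.exists_eq hnp o
  have hm₀ : 0 < simpMom (n := n) p fun _ => 1 := simpMom_one_pos hp (by omega)
  have hqm := hsplit.eq_combo hp hcont hhom (isSplit_simpMom hp) (continuous_simpMom hp) hm₀.ne'
    (simpMom_const p)
  refine ⟨α, δ, _, _, hα, hδ, div_nonneg (hnonneg fun _ => 1) hm₀.le,
    div_nonneg (hnonneg fun _ => -1) hm₀.le, fun P hP x => ?_⟩
  obtain ⟨V, rfl⟩ := hP.exists_hull0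
  have hval : IsVal fun P : Set (Euc n) => Φ P x -
      (q (fun _ => 1) / simpMom (n := n) p (fun _ => 1) * mPlus p P x ^ p +
        q (fun _ => -1) / simpMom (n := n) p (fun _ => 1) * mMinus p P x ^ p
        + α * supp P x ^ p + δ * supp P (-x) ^ p) := by
    intro K L hK hL hU hI
    have h1 := hΦ.val x K L hK hL hU hI
    have h2 := isVal_combination hp α δ (q (fun _ => 1) / simpMom (n := n) p (fun _ => 1))
      (q (fun _ => -1) / simpMom (n := n) p (fun _ => 1)) x K L hK hL hU hI
    dsimp only at h1 h2 ⊢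
    linarith
  refine sub_eq_zero.1 (hval.eq_zero (fun V hV => ?_) V)
  obtain ⟨A, I, hA, hVA⟩ := exists_matAct_stdSimp (by omega) hV
  rw [sub_eq_zero, hVA, hΦ.eq_simplexValue o I hA.ne', hq I _ hA, extremeFun_eq_supp hp,
    mPlus_rpow hp, mMinus_rpow hp, supp_matAct, supp_matAct, matVec_neg, add_comm, ← add_assoc]
  congr 2
  split_ifs with hI
  · rw [hI, mom_matAct (isPolytope0_stdSimp _) hA.ne', mom_matAct (isPolytope0_stdSimp _) hA.ne',
      hqm, abs_of_pos hA, matVec_neg]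
    simp only [simpMom, WithLp.toLp_neg, WithLp.toLp_ofLp]
    ring
  · rw [mom_matAct_stdSimp_of_ne_univ hI, mom_matAct_stdSimp_of_ne_univ hI]
    ring

end Assembly

/-- Theorem 5.1: for `n ≥ 3, 1 < p` or `n ≥ 4, p = 1`, a map `Φ : P_o^n → C_p(ℝ^n)` with
`Φ P` non-negative and `(Φ P)^{1/p}` sublinear is an `SL(n)` covariant valuation iff
`Φ P = c₁ h_{M_p⁺P}^p + c₂ h_{M_p⁻P}^p + a₁ h_P^p + b₁ h_{-P}^p` for some
`a₁, b₁, c₁, c₂ ≥ 0`. -/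
theorem function_valued_valuation_classification_sublinear (n : ℕ) (p : ℝ)
    (hnp : (3 ≤ n ∧ 1 < p) ∨ (4 ≤ n ∧ p = 1))
    (Φ : Set (Euc n) → Euc n → ℝ)
    (hCp : ∀ P : Set (Euc n), IsPolytope0 P → Continuous (Φ P) ∧
      ∀ c : ℝ, 0 ≤ c → ∀ x : Euc n, Φ P (c • x) = c ^ p * Φ P x)
    (hpos : ∀ P : Set (Euc n), IsPolytope0 P → ∀ x : Euc n, 0 ≤ Φ P x)
    (hsub : ∀ P : Set (Euc n), IsPolytope0 P →
      (∀ c : ℝ, 0 ≤ c → ∀ x : Euc n, Φ P (c • x) ^ (1 / p) = c * Φ P x ^ (1 / p)) ∧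
      (∀ x y : Euc n, Φ P (x + y) ^ (1 / p) ≤ Φ P x ^ (1 / p) + Φ P y ^ (1 / p))) :
    ((∀ K L : Set (Euc n), IsPolytope0 K → IsPolytope0 L → IsPolytope0 (K ∪ L) →
        IsPolytope0 (K ∩ L) → ∀ x : Euc n,
        Φ (K ∪ L) x + Φ (K ∩ L) x = Φ K x + Φ L x) ∧
      (∀ (φ : Matrix.SpecialLinearGroup (Fin n) ℝ) (P : Set (Euc n)), IsPolytope0 P →
        ∀ x : Euc n, Φ (matAct (φ : Matrix (Fin n) (Fin n) ℝ) P) x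
          = Φ P (matVec ((φ : Matrix (Fin n) (Fin n) ℝ))ᵀ x))) ↔
      ∃ a₁ b₁ c₁ c₂ : ℝ, 0 ≤ a₁ ∧ 0 ≤ b₁ ∧ 0 ≤ c₁ ∧ 0 ≤ c₂ ∧
        ∀ P : Set (Euc n), IsPolytope0 P → ∀ x : Euc n,
          Φ P x = c₁ * mPlus p P x ^ p + c₂ * mMinus p P x ^ p
            + a₁ * supp P x ^ p + b₁ * supp P (-x) ^ p := by
  constructor
  · rintro ⟨hval, hcov⟩
    exact IsSublinVal.exists_combination
      ⟨fun P hP => (hCp P hP).1, fun P hP => (hCp P hP).2, hpos, fun P hP => (hsub P hP).2,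
        fun x K L hK hL hU hI => hval K L hK hL hU hI x,
        fun A hA P hP x => hcov ⟨A, hA⟩ P hP x⟩ hnp
  · rintro ⟨a₁, b₁, c₁, c₂, -, -, -, -, h⟩
    have hp : 0 < p := by rcases hnp with h | h <;> linarith
    constructor
    · intro K L hK hL hU hI x
      rw [h _ hU, h _ hI, h K hK, h L hL]
      exact isVal_combination hp a₁ b₁ c₁ c₂ x K L hK hL hU hI
    · intro φ P hP x
      rw [h _ (hP.matAct _), h P hP]
      exact combination_matAct hp a₁ b₁ c₁ c₂ φ hP x
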